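/- arXiv:1411.6089 — 4 statements merged into one kernel-verified Lean document; each statement's English description precedes it below -/
import Mathlib

section
/- Let F be a field of characteristic p > 0 and let T : Fields/F → Sets be a functor. If there exists a nontrivial cohomological invariant of degree n+1 associated to T (with values in Kato's cohomology group H^{n+1}_p), then the essential dimension of T satisfies ed(T) ≥ n+1. -/
/-!
Statement 0: Let `F` be a field of characteristic `p > 0` and let `T : Fields/F → Sets` be a
functor.  If there exists a nontrivial cohomological invariant of degree `n+1` associated to `T`
(with values in Kato's cohomology group `H^{n+1}_p`), then `ed(T) ≥ n + 1`.
-/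

universe u v

noncomputable section

/-- The wedge product `v 0 ∧ v 1 ∧ … ∧ v (n-1)` of `n` absolute Kähler `1`-forms, as an element
of the `n`-th exterior power `Ω^n_K` of the module of absolute Kähler differentials. -/
def KahlerWedge (K : Type*) [Field K] (n : ℕ) (v : Fin n → Ω[K⁄ℤ]) : ⋀[K]^n (Ω[K⁄ℤ]) :=
  ⟨ExteriorAlgebra.ιMulti K n v, ExteriorAlgebra.ιMulti_range K n (Set.mem_range_self v)⟩

/-- The subgroup `dΩ^{n-1}_K ⊆ Ω^n_K` of exact forms: it is additively generated by the forms
`dy ∧ dx₁ ∧ … ∧ dx_{n-1} = d(y · dx₁ ∧ … ∧ dx_{n-1})`, i.e. by the wedges of `n` exact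
`1`-forms (for `n = 0` it is the zero subgroup, since `Ω^{-1} = 0`). -/
def exactSubgroup (K : Type*) [Field K] : (n : ℕ) → AddSubgroup (⋀[K]^n (Ω[K⁄ℤ]))
  | 0 => ⊥
  | (m + 1) => AddSubgroup.closure
      {ω | ∃ g : Fin (m + 1) → K,
        ω = KahlerWedge K (m + 1) (fun i => KaehlerDifferential.D ℤ K (g i))}

/-- The subgroup of `Ω^n_K` generated by the image of the Artin–Schreier operator `℘` on
logarithmic generators, i.e. by the elements `(y^p − y) · dx₁/x₁ ∧ … ∧ dxₙ/xₙ`. -/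
def artinSchreierSubgroup (p : ℕ) (K : Type*) [Field K] (n : ℕ) :
    AddSubgroup (⋀[K]^n (Ω[K⁄ℤ])) :=
  AddSubgroup.closure
    {ω | ∃ (y : K) (x : Fin n → K), (∀ i, x i ≠ 0) ∧
      ω = (y ^ p - y) •
        KahlerWedge K n (fun i => (x i)⁻¹ • KaehlerDifferential.D ℤ K (x i))}

/-- Kato's cohomology group `H^{n+1}_p(K)`: the cokernel of
`℘ : Ω^n_K → Ω^n_K / dΩ^{n-1}_K`, realized as the quotient of `Ω^n_K` by the subgroup generated
by the exact forms together with the images of the logarithmic generators under `℘`. -/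
abbrev KatoH (p : ℕ) (K : Type*) [Field K] (n : ℕ) :=
  (⋀[K]^n (Ω[K⁄ℤ])) ⧸ (exactSubgroup K n ⊔ artinSchreierSubgroup p K n)

/-- `trdeg_F E ≤ n`: there are at most `n` elements of `E` over which `E` is algebraic. -/
def TrdegLE (F E : Type*) [Field F] [Field E] [Algebra F E] (n : ℕ) : Prop :=
  ∃ s : Finset E, s.card ≤ n ∧
    Algebra.IsAlgebraic (IntermediateField.adjoin F (s : Set E)) E

/-- A functor `T : Fields/F → Sets` from the category of field extensions of `F`
(with morphisms the `F`-algebra homomorphisms) to the category of sets. -/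
structure FieldFunctor (F : Type u) [Field F] where
  /-- the value of the functor on a field extension `K/F` -/
  obj : ∀ (K : Type u) [Field K] [Algebra F K], Type v
  /-- the value of the functor on a morphism of field extensions of `F` -/
  map : ∀ {K L : Type u} [Field K] [Algebra F K] [Field L] [Algebra F L],
    (K →ₐ[F] L) → obj K → obj L
  map_id : ∀ (K : Type u) [Field K] [Algebra F K] (t : obj K), map (AlgHom.id F K) t = t
  map_comp : ∀ {K L M : Type u} [Field K] [Algebra F K] [Field L] [Algebra F L]
    [Field M] [Algebra F M] (f : K →ₐ[F] L) (g : L →ₐ[F] M) (t : obj K),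
    map (g.comp f) t = map g (map f t)

/-- `ed(T) ≤ m`: every element `t ∈ T(K)`, for every field extension `K/F`, is defined over an
intermediate field `F ⊆ E ⊆ K` of transcendence degree at most `m` over `F`. -/
def FieldFunctor.edLE {F : Type u} [Field F] (T : FieldFunctor.{u, v} F) (m : ℕ) : Prop :=
  ∀ (K : Type u) [Field K] [Algebra F K] (t : T.obj K),
    ∃ E : IntermediateField F K, TrdegLE F E m ∧ ∃ s : T.obj E, T.map E.val s = t

/-- A cohomological invariant of degree `n+1` associated to `T`, with values in Kato's
cohomology groups `H^{n+1}_p(−)`: a morphism of functors `q : T → H^{n+1}_p(−)`.  Naturality is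
expressed on representatives: for any `F`-algebra homomorphism `f : K → L` and any additive map
`W : Ω^n_K → Ω^n_L` implementing the functoriality of differential forms (i.e. sending
`y₁·dg₁ ∧ ⋯ ∧ yₙ·dgₙ` to `f(y₁)·d(f g₁) ∧ ⋯ ∧ f(yₙ)·d(f gₙ)`; such a map exists and is unique),
`W` carries representatives of `q_K(t)` to representatives of `q_L(T(f)(t))`. -/
structure CohInvariant (F : Type u) [Field F] (p n : ℕ) (T : FieldFunctor.{u, v} F) where
  /-- the component of the invariant at a field extension `K/F` -/
  app : ∀ (K : Type u) [Field K] [Algebra F K], T.obj K → KatoH p K n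
  natural : ∀ (K L : Type u) [Field K] [Algebra F K] [Field L] [Algebra F L]
      (f : K →ₐ[F] L) (W : (⋀[K]^n (Ω[K⁄ℤ])) →+ (⋀[L]^n (Ω[L⁄ℤ]))),
      (∀ (y g : Fin n → K),
        W (KahlerWedge K n fun i => y i • KaehlerDifferential.D ℤ K (g i)) =
          KahlerWedge L n fun i => f (y i) • KaehlerDifferential.D ℤ L (f (g i))) →
      ∀ (t : T.obj K) (ω : ⋀[K]^n (Ω[K⁄ℤ])),
        QuotientAddGroup.mk ω = app K t →
          QuotientAddGroup.mk (W ω) = app L (T.map f t)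

/-- An invariant `q` is nontrivial if there are a field extension `K/F` containing an algebraic
closure of `F` and an element `t ∈ T(K)` with `q_K(t) ≠ 0` in `H^{n+1}_p(K)`. -/
def CohInvariant.Nontrivial {F : Type u} [Field F] {p n : ℕ} {T : FieldFunctor.{u, v} F}
    (q : CohInvariant F p n T) : Prop :=
  ∃ (K : Type u) (_ : Field K) (_ : Algebra F K),
    Nonempty (AlgebraicClosure F →ₐ[F] K) ∧ ∃ t : T.obj K, q.app K t ≠ 0


theorem aux_lang {k M : Type*} [Field k] [IsAlgClosed k] (p : ℕ) [Fact p.Prime] [CharP k p]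
    [AddCommGroup M] [Module k M] [Module.Finite k M] (S : AddSubgroup M) (C : M → M)
    (h : ∀ (c : k) (v : M), c ^ p • v - c • C v ∈ S) (v : M) : v ∈ S := by
  classical
  have hp : p.Prime := Fact.out
  set w : ℕ → M := fun i => C^[i] v with hw
  have hws : ∀ i, w (i + 1) = C (w i) := fun i => Function.iterate_succ_apply' C i v
  obtain ⟨m, c, hc, j, hjm, hj⟩ : ∃ (m : ℕ) (c : ℕ → k),
      ∑ i ∈ Finset.range m, c i • w i = 0 ∧ ∃ j < m, c j ≠ 0 := by
    set d := Module.finrank k M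
    have hdep : ¬ LinearIndependent k (fun i : Fin (d + 1) => w i) := by
      intro hli
      have := hli.fintype_card_le_finrank
      simp [d] at this
    rw [Fintype.not_linearIndependent_iff] at hdep
    obtain ⟨g, hg, i, hi⟩ := hdep
    refine ⟨d + 1, fun i => if hi : i < d + 1 then g ⟨i, hi⟩ else 0, ?_, i, i.2, by simpa only [i.2, dif_pos] using hi⟩
    rw [Finset.sum_range, ← hg]
    exact Finset.sum_congr rfl fun i _ => by simp only [i.2, dif_pos]
  set P : Polynomial k := 1 + ∑ i ∈ Finset.range m,
    Polynomial.C (c i ^ p ^ i) * Polynomial.X ^ p ^ i with hP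
  have hdeg : P.degree ≠ 0 := by
    intro h0
    have h1 : P.coeff (p ^ j) = 0 := by
      apply Polynomial.coeff_eq_zero_of_degree_lt
      rw [h0]; exact_mod_cast pow_pos hp.pos j
    rw [hP, Polynomial.coeff_add, Polynomial.finsetSum_coeff, Finset.sum_eq_single j] at h1
    · rw [Polynomial.coeff_one, if_neg (pow_pos hp.pos j).ne'] at h1
      rw [Polynomial.coeff_C_mul, Polynomial.coeff_X_pow, if_pos rfl, zero_add, mul_one] at h1
      exact hj (eq_zero_of_pow_eq_zero h1)
    · intro b _ hb
      rw [Polynomial.coeff_C_mul, Polynomial.coeff_X_pow, if_neg, mul_zero]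
      intro e
      exact hb (Nat.pow_right_injective hp.two_le e).symm
    · intro hh; simp at hh; omega
  obtain ⟨l, hl⟩ := IsAlgClosed.exists_root P hdeg
  have hl' : 1 + ∑ i ∈ Finset.range m, (l * c i) ^ p ^ i = 0 := by
    have := hl
    simp only [Polynomial.IsRoot, hP, Polynomial.eval_add, Polynomial.eval_one,
      Polynomial.eval_finsetSum, Polynomial.eval_mul, Polynomial.eval_C, Polynomial.eval_pow,
      Polynomial.eval_X] at this
    rw [← this]; congr 1; refine Finset.sum_congr rfl fun i _ => ?_
    rw [mul_pow, mul_comm]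
  have key : ∀ i, ∃ r : k, r ^ p ^ i = 1 + ∑ j ∈ Finset.range i, (l * c j) ^ p ^ j ∧
      v + ∑ j ∈ Finset.range i, (l * c j) • w j - r • w i ∈ S := by
    intro i
    induction i with
    | zero => exact ⟨1, by simp, by simp [hw]⟩
    | succ i ih =>
      obtain ⟨r, hr, hrS⟩ := ih
      obtain ⟨s, hs⟩ := IsAlgClosed.exists_pow_nat_eq (r + l * c i) hp.pos
      refine ⟨s, ?_, ?_⟩
      · rw [pow_succ', pow_mul, hs, add_pow_char_pow, hr, Finset.sum_range_succ, add_assoc]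
      · have := S.add_mem hrS (h s (w i))
        rw [hs, ← hws] at this
        convert this using 1
        rw [Finset.sum_range_succ, add_smul]
        abel
  obtain ⟨r, hr, hrS⟩ := key m
  rw [hl'] at hr
  have hr0 : r = 0 := by simpa using eq_zero_of_pow_eq_zero hr
  have : ∑ j ∈ Finset.range m, (l * c j) • w j = 0 := by
    simp_rw [mul_smul]; rw [← Finset.smul_sum, hc, smul_zero]
  simpa [this, hr0] using hrS

open MvPolynomial in
theorem aux_poly {k K : Type*} [Field k] [IsAlgClosed k] (p : ℕ) [Fact p.Prime]
    [Field K] [CharP K p] [Algebra k K] {n : ℕ} (t : Fin n → K) (S : AddSubgroup K)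
    (h1 : ∀ (z : K) (b : Fin n → ℕ), (∃ j, ¬ p ∣ b j + 1) → z ^ p * ∏ i, t i ^ b i ∈ S)
    (h2 : ∀ z : K, z ^ p * ∏ i, t i ^ (p - 1) - z ∈ S) (R : ℕ)
    (g : MvPolynomial (Fin n) k) (hg : g.totalDegree ≤ p * R) :
    ∃ h : MvPolynomial (Fin n) k, h.totalDegree ≤ R ∧
      ∀ z : K, z ^ p * aeval t g - z * aeval t h ∈ S := by
  classical
  have hp : p.Prime := Fact.out
  have mono : ∀ b ∈ g.support, ∃ h : MvPolynomial (Fin n) k, h.totalDegree ≤ R ∧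
      ∀ z : K, z ^ p * aeval t (monomial b (g.coeff b)) - z * aeval t h ∈ S := by
    intro b hb
    obtain ⟨c, hc⟩ := IsAlgClosed.exists_pow_nat_eq (g.coeff b) hp.pos
    by_cases hj : ∃ j, ¬ p ∣ b j + 1
    · refine ⟨0, by simp, fun z => ?_⟩
      have := h1 (z * algebraMap k K c) b hj
      simp only [map_zero, mul_zero, sub_zero]
      convert this using 1
      rw [aeval_monomial, ← hc, map_pow, Finsupp.prod_fintype _ _ (by simp)]
      ring
    · push Not at hj
      choose a ha using hj
      have ha1 : ∀ j, b j = p * (a j - 1) + (p - 1) := by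
        intro j
        have : a j ≠ 0 := by rintro e; have := ha j; simp [e] at this
        obtain ⟨a', ha'⟩ := Nat.exists_eq_succ_of_ne_zero this
        have h3 := ha j
        rw [ha'] at h3 ⊢
        have := hp.pos
        simp only [Nat.succ_sub_one]
        rw [Nat.mul_succ] at h3
        omega
      let a' : Fin n →₀ ℕ := Finsupp.equivFunOnFinite.symm fun j => a j - 1
      have ha' : ∀ j, a' j = a j - 1 := fun j => rfl
      refine ⟨monomial a' c, ?_, fun z => ?_⟩
      · refine (totalDegree_monomial_le _ _).trans ?_
        have h5 := (le_totalDegree hb).trans hg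
        rw [Finsupp.sum_fintype _ _ (by simp)] at h5 ⊢
        refine Nat.le_of_mul_le_mul_left ?_ hp.pos
        refine le_trans ?_ h5
        rw [Finset.mul_sum]
        refine Finset.sum_le_sum fun i _ => ?_
        rw [ha1 i, ha']; exact Nat.le_add_right _ _
      · have := h2 (z * (algebraMap k K c * ∏ i, t i ^ a' i))
        convert this using 1
        rw [aeval_monomial, aeval_monomial, ← hc, map_pow, Finsupp.prod_fintype _ _ (by simp),
          Finsupp.prod_fintype _ _ (by simp)]
        congr 1
        simp_rw [mul_pow, ← Finset.prod_pow, ← pow_mul, ha1, pow_add, Finset.prod_mul_distrib, ha',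
          mul_comm p]
        ring
  choose! H hH1 hH2 using mono
  refine ⟨∑ b ∈ g.support, H b, ?_, fun z => ?_⟩
  · exact (totalDegree_finsetSum _ _).trans (Finset.sup_le hH1)
  · conv => enter [2, 1]; rw [g.as_sum]
    rw [map_sum, map_sum, Finset.mul_sum, Finset.mul_sum, ← Finset.sum_sub_distrib]
    exact S.sum_mem fun b hb => hH2 b hb z

open MvPolynomial in
theorem aux_span {k K : Type*} [Field k] [IsAlgClosed k] (p : ℕ) [Fact p.Prime]
    [Field K] [CharP k p] [CharP K p] [Algebra k K] {n : ℕ} (t : Fin n → K) (S : AddSubgroup K)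
    (h1 : ∀ (z : K) (b : Fin n → ℕ), (∃ j, ¬ p ∣ b j + 1) → z ^ p * ∏ i, t i ^ b i ∈ S)
    (h2 : ∀ z : K, z ^ p * ∏ i, t i ^ (p - 1) - z ∈ S)
    {N : ℕ} (e : Fin N → K) (D : K) (hD : D ≠ 0) (M : Fin N → Fin N → MvPolynomial (Fin n) k)
    (hM : ∀ i, D ^ (p - 1) * e i = ∑ j, aeval t (M i j) * e j ^ p)
    (A : Fin N → MvPolynomial (Fin n) k) (u : K) (hu : D * u = ∑ i, aeval t (A i) * e i) :
    u ∈ S := by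
  classical
  have hp : p.Prime := Fact.out
  obtain ⟨R, hRM, hRA⟩ : ∃ R : ℕ, (∀ i j, (M i j).totalDegree ≤ R) ∧
      ∀ i, (A i).totalDegree ≤ R := by
    refine ⟨∑ i, ∑ j, (M i j).totalDegree + ∑ i, (A i).totalDegree, fun i j => ?_, fun i => ?_⟩
    · refine le_trans ?_ (Nat.le_add_right _ _)
      exact (Finset.single_le_sum (f := fun j => (M i j).totalDegree) (fun _ _ => Nat.zero_le _)
        (Finset.mem_univ j)).trans (Finset.single_le_sum
          (f := fun i => ∑ j, (M i j).totalDegree) (fun _ _ => Nat.zero_le _) (Finset.mem_univ i))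
    · refine le_trans ?_ (Nat.le_add_left _ _)
      exact Finset.single_le_sum (f := fun i => (A i).totalDegree) (fun _ _ => Nat.zero_le _)
        (Finset.mem_univ i)
  let V := Fin N → restrictTotalDegree (Fin n) k R
  have : Module.Finite k (restrictTotalDegree (Fin n) k R) := inferInstance
  let φ : V →ₗ[k] K := ∑ i, ((LinearMap.mulRight k (D⁻¹ * e i)).comp
    ((aeval t).toLinearMap.comp ((restrictTotalDegree (Fin n) k R).subtype.comp (LinearMap.proj i))))
  have hφ : ∀ g : V, φ g = ∑ i, aeval t (g i).1 * (D⁻¹ * e i) := fun g => by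
    simp only [φ, LinearMap.sum_apply]; rfl
  have hstep : ∀ g : V, ∃ g' : V, ∀ c : k, c ^ p • φ g - c • φ g' ∈ S := by
    intro g
    have hG : ∀ j, (∑ i, (g i).1 * M i j).totalDegree ≤ p * R := fun j => by
      refine (totalDegree_finsetSum _ _).trans (Finset.sup_le fun i _ => ?_)
      refine (totalDegree_mul _ _).trans ?_
      have h3 := (mem_restrictTotalDegree _ _ _).1 (g i).2
      have h4 := hRM i j
      nlinarith [hp.two_le]
    choose H hH1 hH2 using fun j => aux_poly p t S h1 h2 R _ (hG j)
    refine ⟨fun j => ⟨H j, (mem_restrictTotalDegree _ _ _).2 (hH1 j)⟩, fun c => ?_⟩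
    have := S.sum_mem (t := Finset.univ) fun j _ => hH2 j (algebraMap k K c * (D⁻¹ * e j))
    convert this using 1
    rw [Finset.sum_sub_distrib, hφ, hφ, Algebra.smul_def, Algebra.smul_def, map_pow]
    congr 1
    · have e1 : ∀ i, D⁻¹ * e i = (D⁻¹) ^ p * ∑ j, aeval t (M i j) * e j ^ p := fun i => by
        rw [← hM, ← mul_assoc]
        congr 1
        obtain ⟨q, rfl⟩ := Nat.exists_eq_succ_of_ne_zero hp.ne_zero
        simp only [Nat.succ_sub_one]
        rw [pow_succ', mul_assoc, ← mul_pow, inv_mul_cancel₀ hD, one_pow, mul_one]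
      have e2 : ∑ i, aeval t (g i).1 * (D⁻¹ * e i) =
          ∑ i, ∑ j, aeval t (g i).1 * ((D⁻¹) ^ p * (aeval t (M i j) * e j ^ p)) :=
        Finset.sum_congr rfl fun i _ => by rw [e1, Finset.mul_sum, Finset.mul_sum]
      rw [e2]
      simp_rw [map_sum, map_mul, Finset.mul_sum]
      rw [Finset.sum_comm]
      refine Finset.sum_congr rfl fun i _ => Finset.sum_congr rfl fun j _ => by ring
    · rw [Finset.mul_sum]
      refine Finset.sum_congr rfl fun i _ => by ring
  choose Cop hCop using hstep
  have := aux_lang (k := k) p (S.comap φ.toAddMonoidHom) Cop (fun c v => by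
    simpa using hCop v c) (fun i => ⟨A i, (mem_restrictTotalDegree _ _ _).2 (hRA i)⟩)
  have h5 : φ (fun i => ⟨A i, (mem_restrictTotalDegree _ _ _).2 (hRA i)⟩) ∈ S := this
  rw [hφ] at h5
  convert h5 using 1
  apply mul_left_cancel₀ hD
  rw [hu, Finset.mul_sum]
  refine Finset.sum_congr rfl fun i _ => ?_
  field_simp

theorem aux_denom {k L : Type*} [Field k] [Field L] [Algebra k L] {n : ℕ} (t : Fin n → L)
    {ι : Type*} [Fintype ι] (x : ι → L)
    (hx : ∀ a, x a ∈ IntermediateField.adjoin k (Set.range t)) :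
    ∃ (D : MvPolynomial (Fin n) k) (r : ι → MvPolynomial (Fin n) k),
      MvPolynomial.aeval t D ≠ 0 ∧
      ∀ a, MvPolynomial.aeval t D * x a = MvPolynomial.aeval t (r a) := by
  classical
  have : ∀ a, ∃ r s : MvPolynomial (Fin n) k, MvPolynomial.aeval t s ≠ 0 ∧
      MvPolynomial.aeval t s * x a = MvPolynomial.aeval t r := by
    intro a
    obtain ⟨r, s, hrs⟩ := (IntermediateField.mem_adjoin_range_iff k t (x a)).1 (hx a)
    by_cases hs : MvPolynomial.aeval t s = 0
    · exact ⟨0, 1, by simp, by simp [hrs, hs]⟩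
    · exact ⟨r, s, hs, by rw [hrs]; field_simp⟩
  choose r s hs hrs using this
  refine ⟨∏ a, s a, fun a => r a * ∏ b ∈ Finset.univ.erase a, s b, ?_, fun a => ?_⟩
  · rw [map_prod]; exact Finset.prod_ne_zero_iff.2 fun a _ => hs a
  · rw [← Finset.mul_prod_erase _ _ (Finset.mem_univ a), map_mul, map_mul, ← hrs]; ring

theorem aux_all {k L : Type*} [Field k] [IsAlgClosed k] (p : ℕ) [Fact p.Prime]
    [Field L] [CharP k p] [CharP L p] [Algebra k L] [Algebra.EssFiniteType k L]
    {n : ℕ} (t : Fin n → L)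
    [Algebra.IsSeparable (IntermediateField.adjoin k (Set.range t)) L] (S : AddSubgroup L)
    (h1 : ∀ (z : L) (b : Fin n → ℕ), (∃ j, ¬ p ∣ b j + 1) → z ^ p * ∏ i, t i ^ b i ∈ S)
    (h2 : ∀ z : L, z ^ p * ∏ i, t i ^ (p - 1) - z ∈ S) (u : L) : u ∈ S := by
  classical
  have hp : p.Prime := Fact.out
  set K₀ := IntermediateField.adjoin k (Set.range t) with hK₀
  have : Algebra.EssFiniteType K₀ L := Algebra.EssFiniteType.of_comp k K₀ L
  have : Module.Finite K₀ L := Algebra.finite_of_essFiniteType_of_isAlgebraic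
  have : CharP K₀ p := charP_of_injective_algebraMap (algebraMap k K₀).injective p
  have : ExpChar K₀ p := ExpChar.prime hp
  let e := Module.finBasis K₀ L
  have hsp := Field.span_map_pow_expChar_pow_eq_top_of_isSeparable (F := K₀) p 1 e.span_eq
  have hM : ∀ i, ∃ c : Fin (Module.finrank K₀ L) → K₀, ∑ j, c j • e j ^ p = e i := by
    intro i
    have : e i ∈ Submodule.span K₀ (Set.range (fun j => e j ^ p ^ 1)) := by rw [hsp]; trivial
    rw [Submodule.mem_span_range_iff_exists_fun] at this
    simpa using this
  choose c hc using hM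
  obtain ⟨D, r, hD, hr⟩ := aux_denom (k := k) t
    (Sum.elim (fun ij : Fin (Module.finrank K₀ L) × Fin (Module.finrank K₀ L) => (c ij.1 ij.2 : L))
      (fun i => (e.repr u i : L))) (by rintro (a | a) <;> exact SetLike.coe_mem _)
  refine aux_span (k := k) p t S h1 h2 e (MvPolynomial.aeval t D) hD
    (fun i j => D ^ (p - 2) * r (Sum.inl (i, j))) (fun i => ?_) (fun i => r (Sum.inr i)) u ?_
  · obtain ⟨q, hq⟩ := Nat.exists_eq_add_of_le hp.two_le
    have e1 : p - 1 = (p - 2) + 1 := by omega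
    conv_lhs => rw [← hc i]
    rw [Finset.mul_sum]
    refine Finset.sum_congr rfl fun j _ => ?_
    rw [map_mul, ← hr, map_pow, e1, pow_succ]
    simp only [Sum.elim_inl, Algebra.smul_def]
    change _ * ((c i j : L) * _) = _
    ring
  · conv_lhs => rw [← e.sum_repr u]
    rw [Finset.mul_sum]
    refine Finset.sum_congr rfl fun j _ => ?_
    rw [← hr]
    simp only [Sum.elim_inr, Algebra.smul_def]
    change _ * ((e.repr u j : L) * _) = _
    ring

theorem aux_D_pow {L : Type*} [Field L] (p : ℕ) [CharP L p] (z : L) :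
    KaehlerDifferential.D ℤ L (z ^ p) = 0 := by
  rw [Derivation.leibniz_pow, ← Nat.cast_smul_eq_nsmul L, CharP.cast_eq_zero, zero_smul]

theorem aux_D_span {k L : Type*} [Field k] [IsAlgClosed k] (p : ℕ) [Fact p.Prime]
    [Field L] [CharP k p] [CharP L p] [Algebra k L] {n : ℕ} (t : Fin n → L)
    [Algebra.IsSeparable (IntermediateField.adjoin k (Set.range t)) L] :
    Submodule.span L (Set.range fun i => KaehlerDifferential.D ℤ L (t i)) = ⊤ := by
  have hp : p.Prime := Fact.out
  set Q := Submodule.span L (Set.range fun i => KaehlerDifferential.D ℤ L (t i)) with hQ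
  set K₀ := IntermediateField.adjoin k (Set.range t) with hK₀
  have : CharP K₀ p := charP_of_injective_algebraMap (algebraMap k K₀).injective p
  have : ExpChar K₀ p := ExpChar.prime hp
  have h0 : ∀ x ∈ K₀, KaehlerDifferential.D ℤ L x ∈ Q := by
    intro x hx
    induction hx using IntermediateField.adjoin_induction with
    | mem x hx =>
      obtain ⟨i, rfl⟩ := hx
      exact Submodule.subset_span ⟨i, rfl⟩
    | algebraMap x =>
      obtain ⟨c, hc⟩ := IsAlgClosed.exists_pow_nat_eq x hp.pos
      rw [← hc, map_pow, aux_D_pow p]; exact Q.zero_mem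
    | add x y _ _ hx hy => rw [map_add]; exact Q.add_mem hx hy
    | inv x _ hx => rw [Derivation.leibniz_inv]; exact Q.smul_mem _ hx
    | mul x y _ _ hx hy =>
      rw [Derivation.leibniz]; exact Q.add_mem (Q.smul_mem _ hy) (Q.smul_mem _ hx)
  have hsp := Field.span_map_pow_expChar_pow_eq_top_of_isSeparable (F := K₀) (E := L)
    (v := (id : L → L)) p 1 (by simp)
  have h1 : ∀ x : L, KaehlerDifferential.D ℤ L x ∈ Q := by
    intro x
    have hx : x ∈ Submodule.span K₀ (Set.range (fun y : L => id y ^ p ^ 1)) := by rw [hsp]; trivial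
    induction hx using Submodule.span_induction with
    | mem x hx =>
      obtain ⟨y, rfl⟩ := hx
      simp only [id, pow_one, aux_D_pow p]; exact Q.zero_mem
    | zero => rw [map_zero]; exact Q.zero_mem
    | add x y _ _ hx hy => rw [map_add]; exact Q.add_mem hx hy
    | smul a x _ hx =>
      rw [Algebra.smul_def, Derivation.leibniz]
      exact Q.add_mem (Q.smul_mem _ hx) (Q.smul_mem _ (h0 _ a.2))
  rw [eq_top_iff, ← KaehlerDifferential.span_range_derivation, Submodule.span_le]
  rintro _ ⟨x, rfl⟩
  exact h1 x

theorem aux_top_form {L M : Type*} [Field L] [AddCommGroup M] [Module L M] {n : ℕ} (v : Fin n → M)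
    (hv : Submodule.span L (Set.range v) = ⊤) (ω : ⋀[L]^n M) :
    ∃ a : L, ω = a • exteriorPower.ιMulti L n v := by
  have h := exteriorPower.ιMulti_span_of_span L n M hv
  have hω : ω ∈ Submodule.span L {exteriorPower.ιMulti L n v} := by
    refine (le_of_eq_of_le h.symm (Submodule.span_le.2 ?_)) (Submodule.mem_top)
    rintro _ ⟨a, ha, rfl⟩
    have : ∀ i, ∃ j, v j = a i := fun i => ha ⟨i, rfl⟩
    choose r hr using this
    have har : a = v ∘ r := funext fun i => (hr i).symm
    rw [har, SetLike.mem_coe]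
    by_cases hi : Function.Injective r
    · have hb : Function.Bijective r := Finite.injective_iff_bijective.1 hi
      have := (exteriorPower.ιMulti L n).map_perm v (Equiv.ofBijective r hb)
      have e : (v ∘ r) = v ∘ (Equiv.ofBijective r hb) := rfl
      rw [e, this]
      have h6 := Submodule.mem_span_singleton_self (R := L) (exteriorPower.ιMulti L n v)
      rw [Units.smul_def]
      exact zsmul_mem h6 _
    · have : exteriorPower.ιMulti L n (v ∘ r) = 0 := by
        rw [Function.Injective] at hi
        push Not at hi
        obtain ⟨i, j, hij, hne⟩ := hi
        exact (exteriorPower.ιMulti L n).map_eq_zero_of_eq _ (by simp [hij]) hne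
      rw [this]; exact Submodule.zero_mem _
  obtain ⟨a, ha⟩ := Submodule.mem_span_singleton.1 hω
  exact ⟨a, ha.symm⟩

theorem aux_exact {L : Type*} [Field L] (p : ℕ) [Fact p.Prime] [CharP L p] {n : ℕ} (t : Fin n → L)
    (z : L) (b : Fin n → ℕ) (j : Fin n) (hj : ¬ p ∣ b j + 1) :
    (z ^ p * ∏ i, t i ^ b i) • KahlerWedge L n (fun i => KaehlerDifferential.D ℤ L (t i)) ∈
      exactSubgroup L n := by
  classical
  have hp : p.Prime := Fact.out
  set v : Fin n → Ω[L⁄ℤ] := fun i => KaehlerDifferential.D ℤ L (t i) with hv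
  let ℓ : Ω[L⁄ℤ] →ₗ[L] ⋀[L]^n (Ω[L⁄ℤ]) :=
    (exteriorPower.ιMulti L n (M := Ω[L⁄ℤ])).toMultilinearMap.toLinearMap v j
  have hℓ : ∀ w, ℓ w = exteriorPower.ιMulti L n (Function.update v j w) := fun w => rfl
  let δ : Derivation ℤ L (⋀[L]^n (Ω[L⁄ℤ])) := ℓ.compDer (KaehlerDifferential.D ℤ L)
  have hδ : ∀ x, δ x = ℓ (KaehlerDifferential.D ℤ L x) := fun x => rfl
  have hδ1 : ∀ i, i ≠ j → δ (t i) = 0 := fun i hi => by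
    rw [hδ, hℓ]
    refine (exteriorPower.ιMulti L n).map_eq_zero_of_eq _ (i := i) (j := j) ?_ hi
    simp [Function.update_of_ne hi, hv]
  have hδj : δ (t j) = KahlerWedge L n v := by
    rw [hδ, hℓ]
    have : Function.update v j (KaehlerDifferential.D ℤ L (t j)) = v := Function.update_eq_self j v
    rw [this]; rfl
  have hδ2 : ∀ s : Finset (Fin n), j ∉ s → δ (∏ i ∈ s, t i ^ b i) = 0 := by
    intro s
    induction s using Finset.induction_on with
    | empty => intro _; simp
    | insert a s ha ih =>
      intro hjs
      rw [Finset.mem_insert, not_or] at hjs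
      rw [Finset.prod_insert ha, Derivation.leibniz, ih hjs.2, Derivation.leibniz_pow,
        hδ1 a (Ne.symm hjs.1)]
      simp
  have hδp : δ (z ^ p) = 0 := by rw [hδ, aux_D_pow p, map_zero]
  have hδh : δ (z ^ p * (∏ i ∈ Finset.univ.erase j, t i ^ b i) * t j ^ (b j + 1)) =
      (b j + 1) • ((z ^ p * ∏ i, t i ^ b i) • KahlerWedge L n v) := by
    rw [Derivation.leibniz, Derivation.leibniz (D := δ) (z ^ p), hδp, hδ2 _ (by simp),
      Derivation.leibniz_pow, hδj, ← Finset.mul_prod_erase _ _ (Finset.mem_univ j)]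
    simp only [smul_zero, add_zero, Nat.add_sub_cancel]
    rw [smul_comm, smul_smul]
    congr 2
    ring
  have hmem : (b j + 1) • ((z ^ p * ∏ i, t i ^ b i) • KahlerWedge L n v) ∈ exactSubgroup L n := by
    rw [← hδh]
    cases n with
    | zero => exact j.elim0
    | succ m =>
      refine AddSubgroup.subset_closure ⟨Function.update t j
        (z ^ p * (∏ i ∈ Finset.univ.erase j, t i ^ b i) * t j ^ (b j + 1)), ?_⟩
      rw [hδ, hℓ]
      change KahlerWedge L (m + 1) _ = _
      congr 1
      funext i
      by_cases hi : i = j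
      · subst hi; simp
      · simp [Function.update_of_ne hi, hv]
  have hcop : IsCoprime ((b j + 1 : ℕ) : ℤ) (p : ℤ) := by
    rw [Nat.isCoprime_iff_coprime]
    exact ((Nat.Prime.coprime_iff_not_dvd hp).2 hj).symm
  obtain ⟨x, y, hxy⟩ := hcop
  set ω := (z ^ p * ∏ i, t i ^ b i) • KahlerWedge L n v with hω
  have hpω : (p : ℤ) • ω = 0 := by
    rw [← Int.cast_smul_eq_zsmul L]; simp
  have e : ω = x • ((b j + 1) • ω) := by
    calc ω = (1 : ℤ) • ω := (one_zsmul _).symm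
      _ = (x * ((b j + 1 : ℕ) : ℤ) + y * (p : ℤ)) • ω := by rw [hxy]
      _ = _ := by rw [add_smul, mul_smul, mul_smul, hpω, smul_zero, add_zero, natCast_zsmul]
  rw [e]
  exact zsmul_mem hmem x

theorem aux_vanish {k L : Type*} [Field k] [IsAlgClosed k] (p : ℕ) [Fact p.Prime]
    [Field L] [CharP k p] [CharP L p] [Algebra k L] [Algebra.EssFiniteType k L]
    {n : ℕ} (t : Fin n → L)
    [Algebra.IsSeparable (IntermediateField.adjoin k (Set.range t)) L] (ω : ⋀[L]^n (Ω[L⁄ℤ])) :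
    ω ∈ exactSubgroup L n ⊔ artinSchreierSubgroup p L n := by
  classical
  have hp : p.Prime := Fact.out
  set S := exactSubgroup L n ⊔ artinSchreierSubgroup p L n with hS
  set v : Fin n → Ω[L⁄ℤ] := fun i => KaehlerDifferential.D ℤ L (t i) with hv
  obtain ⟨a, rfl⟩ := aux_top_form v (aux_D_span (k := k) p t) ω
  by_cases h0 : ∃ i, t i = 0
  · obtain ⟨i, hi⟩ := h0
    rw [(exteriorPower.ιMulti L n).map_coord_zero i (by simp [hv, hi]), smul_zero]
    exact S.zero_mem
  push Not at h0
  let S' : AddSubgroup L := S.comap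
    (LinearMap.toSpanSingleton L _ (exteriorPower.ιMulti L n v)).toAddMonoidHom
  have hS' : ∀ x, x ∈ S' ↔ x • exteriorPower.ιMulti L n v ∈ S := fun x => Iff.rfl
  rw [← hS']
  refine aux_all (k := k) p t S' ?_ ?_ a
  · rintro z b ⟨j, hj⟩
    rw [hS']
    exact (le_sup_left : exactSubgroup L n ≤ S) (aux_exact p t z b j hj)
  · intro z
    rw [hS']
    refine (le_sup_right : artinSchreierSubgroup p L n ≤ S)
      (AddSubgroup.subset_closure ⟨z * ∏ i, t i, t, h0, ?_⟩)
    change _ = _ • exteriorPower.ιMulti L n (fun i => (t i)⁻¹ • v i)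
    rw [AlternatingMap.map_smul_univ, smul_smul]
    congr 1
    have hP : ∏ i, t i ≠ 0 := Finset.prod_ne_zero_iff.2 fun i _ => h0 i
    rw [Finset.prod_inv_distrib, Finset.prod_pow, mul_pow]
    obtain ⟨q, hq⟩ := Nat.exists_eq_succ_of_ne_zero hp.ne_zero
    rw [hq, Nat.succ_sub_one, pow_succ (∏ i, t i)]
    field_simp

theorem aux_W (E K : Type*) [Field E] [Field K] [Algebra E K] (n : ℕ) :
    ∃ W : (⋀[E]^n (Ω[E⁄ℤ])) →+ (⋀[K]^n (Ω[K⁄ℤ])), ∀ (y : E) (v : Fin n → Ω[E⁄ℤ]),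
      W (y • KahlerWedge E n v) = algebraMap E K y •
        KahlerWedge K n (fun i => KaehlerDifferential.map ℤ ℤ E K (v i)) := by
  let f : (Ω[E⁄ℤ]) [⋀^Fin n]→ₗ[E] (⋀[K]^n (Ω[K⁄ℤ])) :=
    { ((exteriorPower.ιMulti K n (M := Ω[K⁄ℤ])).toMultilinearMap.restrictScalars E).compLinearMap
        (fun _ => KaehlerDifferential.map ℤ ℤ E K) with
      map_eq_zero_of_eq' := fun v i j h hij =>
        (exteriorPower.ιMulti K n (M := Ω[K⁄ℤ])).map_eq_zero_of_eq
          (fun i => KaehlerDifferential.map ℤ ℤ E K (v i)) (by simp [h]) hij }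
  refine ⟨(exteriorPower.alternatingMapLinearEquiv f).toAddMonoidHom, fun y v => ?_⟩
  have h1 := exteriorPower.alternatingMapLinearEquiv_apply_ιMulti f v
  have h2 : exteriorPower.alternatingMapLinearEquiv f (y • exteriorPower.ιMulti E n v) = y • f v := by
    rw [map_smul, h1]
  refine Eq.trans h2 ?_
  rw [← algebraMap_smul K y (f v)]
  rfl

theorem aux_W_mem (E K : Type*) [Field E] [Field K] [Algebra E K] (p n : ℕ)
    (W : (⋀[E]^n (Ω[E⁄ℤ])) →+ (⋀[K]^n (Ω[K⁄ℤ])))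
    (hW : ∀ (y : E) (v : Fin n → Ω[E⁄ℤ]),
      W (y • KahlerWedge E n v) = algebraMap E K y •
        KahlerWedge K n (fun i => KaehlerDifferential.map ℤ ℤ E K (v i)))
    (ω : ⋀[E]^n (Ω[E⁄ℤ])) (hω : ω ∈ exactSubgroup E n ⊔ artinSchreierSubgroup p E n) :
    W ω ∈ exactSubgroup K n ⊔ artinSchreierSubgroup p K n := by
  have key : exactSubgroup E n ⊔ artinSchreierSubgroup p E n ≤
      (exactSubgroup K n ⊔ artinSchreierSubgroup p K n).comap W := by
    refine sup_le ?_ ?_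
    · cases n with
      | zero => exact bot_le
      | succ m =>
        refine (AddSubgroup.closure_le _).2 ?_
        rintro _ ⟨g, rfl⟩
        refine (le_sup_left : exactSubgroup K (m + 1) ≤ _) (AddSubgroup.subset_closure
          ⟨fun i => algebraMap E K (g i), ?_⟩)
        have := hW 1 fun i => KaehlerDifferential.D ℤ E (g i)
        simpa using this
    · refine (AddSubgroup.closure_le _).2 ?_
      rintro _ ⟨y, x, hx, rfl⟩
      refine (le_sup_right : artinSchreierSubgroup p K n ≤ _) (AddSubgroup.subset_closure
          ⟨algebraMap E K y, fun i => algebraMap E K (x i), fun i => by simpa using hx i, ?_⟩)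
      rw [hW]
      simp only [map_sub, map_pow, map_smul, KaehlerDifferential.map_D]
      congr 2
      funext i
      rw [← algebraMap_smul K (x i)⁻¹, map_inv₀]
  exact key hω

theorem aux_sep {F k K : Type*} [Field F] [Field k] [Field K] [Algebra F k] [Algebra F K]
    [Algebra k K] [IsScalarTower F k K] [PerfectField k] (n : ℕ)
    (E : IntermediateField F K) (hE : TrdegLE F E n) (A : Finset K) (hA : (A : Set K) ⊆ E) :
    ∃ t : Fin n → IntermediateField.adjoin k (A : Set K),
      Algebra.IsSeparable (IntermediateField.adjoin k (Set.range t))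
        (IntermediateField.adjoin k (A : Set K)) := by
  classical
  set L := IntermediateField.adjoin k (A : Set K) with hL
  have hess : Algebra.EssFiniteType k L := IntermediateField.essFiniteType_iff.2 ⟨A, rfl⟩
  obtain ⟨s, hs, hsep⟩ := exists_isTranscendenceBasis_and_isSeparable_of_perfectField k L
  have hcard : s.card ≤ n := by
    obtain ⟨s₀, hs₀, halg⟩ := hE
    have htr : Algebra.trdeg F E ≤ n := by
      have : Algebra.IsAlgebraic (Algebra.adjoin F (s₀ : Set E)) E :=
        IntermediateField.isAlgebraic_adjoin_iff_top.1 halg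
      refine (Algebra.IsAlgebraic.trdeg_le_cardinalMk F (s := (s₀ : Set E))).trans ?_
      simpa using hs₀
    let A' : Set L := {x | (x : K) ∈ A}
    have hA' : IntermediateField.adjoin k A' = ⊤ := by
      have himg : (L.val : L → K) '' A' = A := by
        ext x; constructor
        · rintro ⟨y, hy, rfl⟩; exact hy
        · intro hx
          exact ⟨⟨x, IntermediateField.subset_adjoin k _ hx⟩, hx, rfl⟩
      apply IntermediateField.map_injective L.val
      rw [IntermediateField.adjoin_map, himg, ← AlgHom.fieldRange_eq_map,
        IntermediateField.fieldRange_val]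
    have : Algebra.IsAlgebraic (Algebra.adjoin k A') L := by
      rw [← IntermediateField.isAlgebraic_adjoin_iff_top, hA', Algebra.isAlgebraic_iff_isIntegral]
      exact Algebra.isIntegral_of_surjective IntermediateField.topEquiv.surjective
    obtain ⟨B, hBA, hB⟩ := exists_isTranscendenceBasis_subset (R := k) A'
    have hBs : Cardinal.mk B = s.card := by
      rw [hB.cardinalMk_eq_trdeg, ← hs.cardinalMk_eq_trdeg]; simp
    have hBK : AlgebraicIndependent k (fun b : B => ((b : L) : K)) :=
      hB.1.map' (f := L.val) L.val.injective
    have hBF : AlgebraicIndependent F (fun b : B => ((b : L) : K)) :=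
      hBK.restrictScalars (FaithfulSMul.algebraMap_injective F k)
    have hBE : AlgebraicIndependent F (fun b : B => (⟨((b : L) : K), hA (hBA b.2)⟩ : E)) :=
      AlgebraicIndependent.of_comp E.val hBF
    have h5 := hBE.cardinalMk_le_trdeg
    rw [hBs] at h5
    exact_mod_cast h5.trans htr
  obtain ⟨t, ht⟩ : ∃ t : Fin n → L, (s : Set L) ⊆ Set.range t := by
    refine ⟨fun i => if h : (i : ℕ) < s.card then (s.equivFin.symm ⟨i, h⟩ : L) else 1, ?_⟩
    intro x hx
    refine ⟨Fin.castLE hcard (s.equivFin ⟨x, hx⟩), ?_⟩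
    have : ((Fin.castLE hcard (s.equivFin ⟨x, hx⟩) : Fin n) : ℕ) < s.card :=
      (s.equivFin ⟨x, hx⟩).2
    simp
  refine ⟨t, ?_⟩
  have hle : IntermediateField.adjoin k (s : Set L) ≤ IntermediateField.adjoin k (Set.range t) :=
    IntermediateField.adjoin.mono k _ _ ht
  refine ⟨fun x => ?_⟩
  have hx := hsep.isSeparable' x
  let := (IntermediateField.inclusion hle).toRingHom.toAlgebra
  have : IsScalarTower (IntermediateField.adjoin k (s : Set L))
    (IntermediateField.adjoin k (Set.range t)) L := IsScalarTower.of_algebraMap_eq fun _ => rfl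
  exact IsSeparable.tower_top _ hx

theorem aux_final {k K : Type*} [Field k] [Field K] [Algebra k K] [IsAlgClosed k] (p : ℕ)
    [Fact p.Prime] [CharP k p] (n : ℕ) (L : IntermediateField k K) (hess : Algebra.EssFiniteType k L)
    (τ : Fin n → L) (hτ : Algebra.IsSeparable (IntermediateField.adjoin k (Set.range τ)) L)
    (y : L) (g : Fin n → L) :
    (y : K) • KahlerWedge K n (fun i => KaehlerDifferential.D ℤ K (g i : K)) ∈
      exactSubgroup K n ⊔ artinSchreierSubgroup p K n := by
  have : CharP L p := charP_of_injective_algebraMap (algebraMap k L).injective p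
  obtain ⟨V, hV⟩ := aux_W L K n
  have h6 := aux_vanish (k := k) p τ (y • KahlerWedge L n fun i => KaehlerDifferential.D ℤ L (g i))
  have h7 := aux_W_mem L K p n V hV _ h6
  rw [hV] at h7
  simp only [KaehlerDifferential.map_D] at h7
  exact h7

/-- If `F` is a field of characteristic `p > 0`, `T : Fields/F → Sets` is a
functor and there is a nontrivial cohomological invariant of degree `n+1` (with values in Kato's
cohomology `H^{n+1}_p`) associated to `T`, then `ed(T) ≥ n + 1`. -/
theorem ed_ge_of_nontrivial_cohInvariant {F : Type u} [Field F] (p : ℕ) [Fact p.Prime]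
    [CharP F p] (n : ℕ) (T : FieldFunctor.{u, v} F) (q : CohInvariant F p n T)
    (hq : q.Nontrivial) :
    ∀ m : ℕ, T.edLE m → n + 1 ≤ m := by
  classical
  intro m hm
  by_contra hmn
  have hmn : m ≤ n := by omega
  obtain ⟨K, iK, iA, ⟨σ⟩, t, ht⟩ := hq
  let : Algebra (AlgebraicClosure F) K := σ.toRingHom.toAlgebra
  have : IsScalarTower F (AlgebraicClosure F) K :=
    IsScalarTower.of_algebraMap_eq fun x => (σ.commutes x).symm
  have : CharP (AlgebraicClosure F) p :=
    charP_of_injective_algebraMap (algebraMap F (AlgebraicClosure F)).injective p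
  obtain ⟨E, ⟨s, hs, halg⟩, t', rfl⟩ := hm K t
  have hE : TrdegLE F E n := ⟨s, hs.trans hmn, halg⟩
  apply ht
  obtain ⟨W, hW⟩ := aux_W E K n
  obtain ⟨ω, hω⟩ := QuotientAddGroup.mk_surjective (q.app E t')
  have hnat := q.natural E K E.val W (fun y g => by
    have := hW 1 fun i => y i • KaehlerDifferential.D ℤ E (g i)
    rw [one_smul, map_one, one_smul] at this
    rw [this]
    congr 1
    funext i
    rw [map_smul, KaehlerDifferential.map_D, ← algebraMap_smul K (y i)]
    rfl) t' ω hω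
  rw [← hnat, QuotientAddGroup.eq_zero_iff]
  have hD : Submodule.span E (Set.range (KaehlerDifferential.D ℤ E)) = ⊤ :=
    KaehlerDifferential.span_range_derivation ℤ E
  have hsp : ω ∈ Submodule.span E (exteriorPower.ιMulti E n ''
      {a | Set.range a ⊆ Set.range (KaehlerDifferential.D ℤ E)}) := by
    rw [exteriorPower.ιMulti_span_of_span E n _ hD]; trivial
  suffices h : ∀ y : E, W (y • ω) ∈ exactSubgroup K n ⊔ artinSchreierSubgroup p K n by
    simpa using h 1
  clear hω hnat
  induction hsp using Submodule.span_induction with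
  | zero => intro y; rw [smul_zero, map_zero]; exact AddSubgroup.zero_mem _
  | add a b _ _ ha hb => intro y; rw [smul_add, map_add]; exact AddSubgroup.add_mem _ (ha y) (hb y)
  | smul c x _ hx => intro y; rw [smul_smul]; exact hx _
  | mem x hx =>
    intro y
    obtain ⟨a, ha, rfl⟩ := hx
    choose g hg using fun i => ha ⟨i, rfl⟩
    have hag : a = fun i => KaehlerDifferential.D ℤ E (g i) := funext fun i => (hg i).symm
    let A : Finset K := insert (y : K) (Finset.univ.image fun i => (g i : K))
    have hA : (A : Set K) ⊆ E := by
      intro x hx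
      simp only [A, Finset.coe_insert, Finset.coe_image, Finset.coe_univ, Set.image_univ,
        Set.mem_insert_iff, Set.mem_range] at hx
      rcases hx with rfl | ⟨i, rfl⟩ <;> exact SetLike.coe_mem _
    have hsep := aux_sep (k := AlgebraicClosure F) n E hE A hA
    have hess : Algebra.EssFiniteType (AlgebraicClosure F)
        (IntermediateField.adjoin (AlgebraicClosure F) (A : Set K)) :=
      IntermediateField.essFiniteType_iff.2 ⟨A, rfl⟩
    have hsub := IntermediateField.subset_adjoin (AlgebraicClosure F) (A : Set K)
    generalize IntermediateField.adjoin (AlgebraicClosure F) (A : Set K) = L at hsep hess hsub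
    obtain ⟨τ, hτ⟩ := hsep
    let yL : L := ⟨y, hsub (by simp [A])⟩
    let gL : Fin n → L := fun i => ⟨g i, hsub (by simp [A])⟩
    have h7 := aux_final p n L hess τ hτ yL gL
    have h8 := hW y a
    change W (y • KahlerWedge E n a) ∈ _
    rw [h8, hag]
    simp only [KaehlerDifferential.map_D] 
    exact h7

end
end

section
/- Let F̄ be an algebraically closed field of characteristic p > 0 and let E be a field extension of F̄ with transcendence degree trdeg_{F̄} E ≤ n. Then Kato's cohomology group H^{n+1}_p(E) vanishes: H^{n+1}_p(E) = 0. -/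
/-!
Statement 1: Let `F` be an algebraically closed field of characteristic `p > 0` and let `E` be a
field extension of `F` with transcendence degree `trdeg_F E ≤ n`.  Then Kato's cohomology group
`H^{n+1}_p(E)` vanishes.

Kato's group `H^{n+1}_p(K)` is the cokernel of the Artin-Schreier operator
`℘ : Ω^n_K → Ω^n_K / dΩ^{n-1}_K`, `℘(y · dx₁/x₁ ∧ … ∧ dxₙ/xₙ) = (y^p − y) · dx₁/x₁ ∧ … ∧ dxₙ/xₙ`,
where `Ω^n_K` is the `n`-th exterior power of the module of absolute Kähler differentials.
Equivalently (by the isomorphism theorems), it is the quotient of `Ω^n_K` by the subgroup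
generated by all exact forms `dy₁ ∧ … ∧ dyₙ` (these additively generate `dΩ^{n-1}_K`)
together with all elements `(y^p − y) · dx₁/x₁ ∧ … ∧ dxₙ/xₙ`.
-/

noncomputable section

theorem kh_dep {p : ℕ} [Fact p.Prime] {F : Type*} [Field F] [IsAlgClosed F] [CharP F p]
    {E : Type*} [Field E] [Algebra F E] {A : Type*} [AddCommGroup A] (φ : E →+ A)
    (V : Submodule F E) [FiniteDimensional F V]
    (hV : ∀ v ∈ V, ∃ v' ∈ V, ∀ c : F, φ (c ^ p • v) = φ (c • v'))
    (b : E) (hb : b ∈ V) : φ b = 0 := by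
  have hp : p.Prime := Fact.out
  choose! C hC1 hC2 using hV
  have hmem : ∀ i : ℕ, C^[i] b ∈ V := by
    intro i
    induction i with
    | zero => exact hb
    | succ k ih => rw [Function.iterate_succ_apply']; exact hC1 _ ih
  have hphi : ∀ (i : ℕ) (c : F), φ (c • C^[i] b) = φ (c ^ (p ^ i) • b) := by
    intro i
    induction i with
    | zero => intro c; simp
    | succ k ih =>
      intro c
      rw [Function.iterate_succ_apply', ← hC2 _ (hmem k), ih, ← pow_mul, pow_succ']
  have hnl : ¬ LinearIndependent F (fun i : ℕ => (⟨C^[i] b, hmem i⟩ : V)) := by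
    intro h
    have := h.finite
    exact not_finite ℕ
  rw [not_linearIndependent_iff] at hnl
  obtain ⟨s, g, hs, i, his, hi⟩ := hnl
  have hs' : ∑ i ∈ s, g i • C^[i] b = 0 := by
    have := congrArg (V.subtype) hs
    simpa using this
  let P : Polynomial F := ∑ i ∈ s, Polynomial.monomial (p ^ i) (g i ^ (p ^ i))
  have hcoef : (P - 1).coeff (p ^ i) ≠ 0 := by
    have h1 : (P - 1).coeff (p ^ i) = g i ^ (p ^ i) := by
      rw [Polynomial.coeff_sub, Polynomial.coeff_one, if_neg (pow_pos hp.pos i).ne', sub_zero,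
        Polynomial.finsetSum_coeff, Finset.sum_eq_single i]
      · simp
      · intro j _ hji
        rw [Polynomial.coeff_monomial, if_neg]
        exact fun h => hji (Nat.pow_right_injective hp.two_le h)
      · exact fun h => absurd his h
    rw [h1]; exact pow_ne_zero _ hi
  have hdeg : (P - 1).degree ≠ 0 := by
    intro h
    have h2 := Polynomial.le_degree_of_ne_zero hcoef
    rw [h] at h2
    have := pow_pos hp.pos i
    have h3 : p ^ i ≤ 0 := by exact_mod_cast h2
    omega
  obtain ⟨t, ht⟩ := IsAlgClosed.exists_root (P - 1) hdeg
  have ht' : ∑ i ∈ s, (g i * t) ^ (p ^ i) = 1 := by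
    have : P.eval t = 1 := by
      have := ht
      simp only [Polynomial.IsRoot, Polynomial.eval_sub, Polynomial.eval_one] at this
      exact sub_eq_zero.mp this
    rw [← this, Polynomial.eval_finsetSum]
    refine Finset.sum_congr rfl fun j _ => ?_
    rw [Polynomial.eval_monomial, mul_pow]
  calc φ b = φ ((∑ i ∈ s, (g i * t) ^ (p ^ i)) • b) := by rw [ht', one_smul]
    _ = ∑ i ∈ s, φ ((g i * t) ^ (p ^ i) • b) := by rw [Finset.sum_smul, map_sum]
    _ = ∑ i ∈ s, φ ((g i * t) • C^[i] b) := by simp_rw [hphi]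
    _ = φ (t • ∑ i ∈ s, g i • C^[i] b) := by
        rw [Finset.smul_sum, map_sum]; simp_rw [smul_smul, mul_comm]
    _ = 0 := by rw [hs']; simp

theorem kh_abs {p : ℕ} [Fact p.Prime] {F : Type*} [Field F] [IsAlgClosed F] [CharP F p]
    {E : Type*} [Field E] [Algebra F E] {A : Type*} [AddCommGroup A] (φ : E →+ A)
    {n : ℕ} (x : Fin n → E)
    (h1 : ∀ (y : E) (J : Fin n → ℕ),
      φ (y ^ p * ∏ i, x i ^ (p * J i + (p - 1))) = φ (y * ∏ i, x i ^ J i))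
    (h2 : ∀ (y : E) (J : Fin n → ℕ) (i : Fin n), ¬ p ∣ J i + 1 →
      φ (y ^ p * ∏ i, x i ^ J i) = 0)
    {ι : Type*} [Fintype ι] (e : ι → E) (h : E) (hh : h ≠ 0)
    (f : ι → ι → MvPolynomial (Fin n) F)
    (hf : ∀ j, h ^ (p - 1) * e j = ∑ k, MvPolynomial.aeval x (f j k) * e k ^ p)
    (a : E) (g : ι → MvPolynomial (Fin n) F)
    (hg : h * a = ∑ j, MvPolynomial.aeval x (g j) * e j) : φ a = 0 := by
  have hp : p.Prime := Fact.out
  let N : ℕ := (∑ j, ∑ k, (f j k).totalDegree) + ∑ j, (g j).totalDegree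
  have hNf : ∀ j k, ∀ J ∈ (f j k).support, ∀ i, J i ≤ N := by
    intro j k J hJ i
    have a1 : J i ≤ (f j k).totalDegree :=
      (Finsupp.le_degree i J).trans (MvPolynomial.le_totalDegree hJ)
    have a2 : (f j k).totalDegree ≤ ∑ k, (f j k).totalDegree :=
      Finset.single_le_sum (f := fun k => (f j k).totalDegree) (fun _ _ => Nat.zero_le _) (Finset.mem_univ k)
    have a3 : ∑ k, (f j k).totalDegree ≤ ∑ j, ∑ k, (f j k).totalDegree :=
      Finset.single_le_sum (f := fun j => ∑ k, (f j k).totalDegree) (fun _ _ => Nat.zero_le _) (Finset.mem_univ j)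
    omega
  have hNg : ∀ j, ∀ J ∈ (g j).support, ∀ i, J i ≤ N := by
    intro j J hJ i
    have a1 : J i ≤ (g j).totalDegree :=
      (Finsupp.le_degree i J).trans (MvPolynomial.le_totalDegree hJ)
    have a2 : (g j).totalDegree ≤ ∑ k, (g k).totalDegree :=
      Finset.single_le_sum (f := fun k => (g k).totalDegree) (fun _ _ => Nat.zero_le _) (Finset.mem_univ j)
    omega
  let gen : (Fin n → Fin (N + 1)) × ι → E :=
    fun q => h⁻¹ * (∏ i, x i ^ (q.1 i : ℕ)) * e q.2
  let V : Submodule F E := Submodule.span F (Set.range gen)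
  have hfd : FiniteDimensional F V := FiniteDimensional.span_of_finite F (Set.finite_range gen)
  have hVmem : ∀ (I : Fin n → ℕ) (j : ι), (∀ i, I i ≤ N) → h⁻¹ * (∏ i, x i ^ I i) * e j ∈ V := by
    intro I j hI
    refine Submodule.subset_span ⟨(fun i => ⟨I i, Nat.lt_succ_of_le (hI i)⟩, j), rfl⟩
  let Q : E → Prop := fun v => ∃ v' ∈ V, ∀ c : F, φ (c ^ p • v) = φ (c • v')
  have Q0 : Q 0 := ⟨0, V.zero_mem, by simp⟩
  have Qadd : ∀ u v, Q u → Q v → Q (u + v) := by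
    rintro u v ⟨u', hu, hu'⟩ ⟨v', hv, hv'⟩
    exact ⟨u' + v', V.add_mem hu hv, fun c => by simp only [smul_add, map_add, hu', hv']⟩
  have Qsmul : ∀ (d : F) u, Q u → Q (d • u) := by
    rintro d u ⟨u', hu, hu'⟩
    obtain ⟨d0, rfl⟩ := IsAlgClosed.exists_pow_nat_eq d hp.pos
    refine ⟨d0 • u', V.smul_mem _ hu, fun c => ?_⟩
    rw [smul_smul, smul_smul, ← mul_pow, hu']
  have Qsum : ∀ {κ : Type _} (s : Finset κ) (u : κ → E), (∀ k ∈ s, Q (u k)) → Q (∑ k ∈ s, u k) :=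
    fun s u hu => Finset.sum_induction u Q Qadd Q0 hu
  have Qsum' : ∀ (s : Finset (Fin n →₀ ℕ)) (u : (Fin n →₀ ℕ) → E), (∀ k ∈ s, Q (u k)) → Q (∑ k ∈ s, u k) :=
    fun s u hu => Finset.sum_induction u Q Qadd Q0 hu
  have Qmon : ∀ (K : Fin n → ℕ) (k : ι), (∀ i, K i ≤ 2 * N) →
      Q ((∏ i, x i ^ K i) * (h⁻¹ * e k) ^ p) := by
    intro K k hK
    have key : ∀ c : F, c ^ p • ((∏ i, x i ^ K i) * (h⁻¹ * e k) ^ p)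
        = (c • (h⁻¹ * e k)) ^ p * ∏ i, x i ^ K i := by
      intro c; rw [smul_pow, smul_mul_assoc, mul_comm]
    by_cases hd : ∃ i, ¬ p ∣ K i + 1
    · obtain ⟨i, hi⟩ := hd
      refine ⟨0, V.zero_mem, fun c => ?_⟩
      rw [key, h2 _ _ i hi]; simp
    · push Not at hd
      choose M hM using hd
      have hM1 : ∀ i, 1 ≤ M i := by
        intro i
        rcases Nat.eq_zero_or_pos (M i) with h0 | h0
        · have := hM i; rw [h0] at this; omega
        · exact h0
      have hKM : ∀ i, K i = p * (M i - 1) + (p - 1) := by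
        intro i
        obtain ⟨m, hm⟩ := Nat.exists_eq_add_of_le (hM1 i)
        have := hM i
        have h2 := hp.two_le
        rw [hm] at this ⊢
        rw [Nat.mul_add] at this
        rw [Nat.add_sub_cancel_left]
        omega
      refine ⟨h⁻¹ * (∏ i, x i ^ (M i - 1)) * e k, hVmem _ k ?_, fun c => ?_⟩
      · intro i
        have e1 := hM i
        have e2 := hK i
        have e3 : 2 * M i ≤ p * M i := Nat.mul_le_mul_right _ hp.two_le
        omega
      · rw [key]
        simp_rw [hKM]
        rw [h1]
        congr 1
        simp only [smul_mul_assoc]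
        congr 1; ring
  have hpoly : ∀ q : MvPolynomial (Fin n) F, MvPolynomial.aeval x q
      = ∑ J ∈ q.support, q.coeff J • ∏ i, x i ^ J i := by
    intro q
    rw [MvPolynomial.aeval_def, MvPolynomial.eval₂_eq']
    simp [Algebra.smul_def]
  have hQV : ∀ v ∈ V, Q v := by
    intro v hv
    induction hv using Submodule.span_induction with
    | zero => exact Q0
    | add u v _ _ hu hv => exact Qadd u v hu hv
    | smul d u _ hu => exact Qsmul d u hu
    | mem u hu =>
      obtain ⟨⟨I, j⟩, rfl⟩ := hu
      have : gen (I, j) = ∑ k, ∑ J ∈ (f j k).support, (f j k).coeff J •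
          ((∏ i, x i ^ ((I i : ℕ) + J i)) * (h⁻¹ * e k) ^ p) := by
        have e1 : gen (I, j) = (∏ i, x i ^ (I i : ℕ)) * (h⁻¹ ^ p * (h ^ (p - 1) * e j)) := by
          have : h⁻¹ ^ p * h ^ (p - 1) = h⁻¹ := by
            obtain ⟨m, hm⟩ := Nat.exists_eq_add_of_le hp.one_le
            rw [hm, Nat.add_sub_cancel_left, pow_add, mul_assoc, ← mul_pow, inv_mul_cancel₀ hh]
            simp
          rw [← mul_assoc (h⁻¹ ^ p), this]
          simp only [gen]; ring
        rw [e1, hf, Finset.mul_sum, Finset.mul_sum]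
        refine Finset.sum_congr rfl fun k _ => ?_
        rw [hpoly, Finset.sum_mul, Finset.mul_sum, Finset.mul_sum]
        refine Finset.sum_congr rfl fun J _ => ?_
        simp only [Algebra.smul_def, pow_add, Finset.prod_mul_distrib, mul_pow]
        ring
      rw [this]
      refine Qsum _ _ fun k _ => Qsum' _ _ fun J hJ => Qsmul _ _ (Qmon _ k fun i => ?_)
      have := hNf j k J hJ i
      have := (I i).2
      omega
  refine kh_dep φ V hQV a ?_
  have ha : a = ∑ j, ∑ J ∈ (g j).support, (g j).coeff J • (h⁻¹ * (∏ i, x i ^ J i) * e j) := by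
    have : a = h⁻¹ * (h * a) := by rw [← mul_assoc, inv_mul_cancel₀ hh, one_mul]
    rw [this, hg, Finset.mul_sum]
    refine Finset.sum_congr rfl fun j _ => ?_
    rw [hpoly, Finset.sum_mul, Finset.mul_sum]
    refine Finset.sum_congr rfl fun J _ => ?_
    simp only [Algebra.smul_def]; ring
  rw [ha]
  exact Submodule.sum_mem _ fun j _ => Submodule.sum_mem _ fun J hJ =>
    V.smul_mem _ (hVmem _ j (hNg j J hJ))

theorem kh_D_pow {p : ℕ} {E : Type*} [Field E] [CharP E p] (y : E) {M : Type*} [AddCommGroup M]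
    [Module E M] (δ : Derivation ℤ E M) : δ (y ^ p) = 0 := by
  rw [Derivation.leibniz_pow, ← Nat.cast_smul_eq_nsmul E, CharP.cast_eq_zero, zero_smul]

/-- the class map -/
def khPhi (p : ℕ) {E : Type*} [Field E] {n : ℕ} (x : Fin n → E) : E →+ KatoH p E n where
  toFun b := QuotientAddGroup.mk (b • KahlerWedge E n (fun i => KaehlerDifferential.D ℤ E (x i)))
  map_zero' := by rw [zero_smul]; rfl
  map_add' a b := by rw [add_smul]; rfl

theorem khPhi_apply (p : ℕ) {E : Type*} [Field E] {n : ℕ} (x : Fin n → E) (b : E) :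
    khPhi p x b = QuotientAddGroup.mk
      (b • KahlerWedge E n (fun i => KaehlerDifferential.D ℤ E (x i))) := rfl

theorem khPhi_h1 (p : ℕ) [Fact p.Prime] {E : Type*} [Field E] {n : ℕ} (x : Fin n → E)
    (hx : ∀ i, x i ≠ 0) (y : E) (J : Fin n → ℕ) :
    khPhi p x (y ^ p * ∏ i, x i ^ (p * J i + (p - 1))) = khPhi p x (y * ∏ i, x i ^ J i) := by
  have hp : p.Prime := Fact.out
  rw [← sub_eq_zero, ← map_sub, khPhi_apply, QuotientAddGroup.eq_zero_iff]
  refine AddSubgroup.mem_sup_right (AddSubgroup.subset_closure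
    ⟨y * ∏ i, x i ^ (J i + 1), x, hx, ?_⟩)
  have hw : KahlerWedge E n (fun i => (x i)⁻¹ • KaehlerDifferential.D ℤ E (x i))
      = (∏ i, (x i)⁻¹) • KahlerWedge E n (fun i => KaehlerDifferential.D ℤ E (x i)) :=
    (exteriorPower.ιMulti E n (M := Ω[E⁄ℤ])).toMultilinearMap.map_smul_univ _ _
  rw [hw, smul_smul]
  congr 1
  rw [sub_mul, mul_pow, ← Finset.prod_pow, mul_assoc, mul_assoc, ← Finset.prod_mul_distrib,
    ← Finset.prod_mul_distrib]
  congr 2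
  · refine Finset.prod_congr rfl fun i _ => ?_
    rw [← pow_mul, eq_mul_inv_iff_mul_eq₀ (hx i), ← pow_succ]
    congr 1
    have := hp.one_le
    rw [Nat.add_mul, Nat.mul_comm]; omega
  · refine Finset.prod_congr rfl fun i _ => ?_
    rw [eq_mul_inv_iff_mul_eq₀ (hx i), ← pow_succ]

theorem khPhi_h2 (p : ℕ) [Fact p.Prime] {E : Type*} [Field E] [CharP E p] {n : ℕ} (x : Fin n → E)
    (y : E) (J : Fin n → ℕ) (i : Fin n) (hi : ¬ p ∣ J i + 1) :
    khPhi p x (y ^ p * ∏ i, x i ^ J i) = 0 := by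
  classical
  obtain _ | m := n
  · exact i.elim0
  rw [khPhi_apply, QuotientAddGroup.eq_zero_iff]
  have hne : ((J i + 1 : ℕ) : E) ≠ 0 := by
    rwa [Ne, CharP.cast_eq_zero_iff E p]
  refine AddSubgroup.mem_sup_left (AddSubgroup.subset_closure ?_)
  let v : Fin (m + 1) → Ω[E⁄ℤ] := fun i => KaehlerDifferential.D ℤ E (x i)
  let lin : Ω[E⁄ℤ] →ₗ[E] ⋀[E]^(m + 1) (Ω[E⁄ℤ]) :=
    (exteriorPower.ιMulti E (m + 1) (M := Ω[E⁄ℤ])).toMultilinearMap.toLinearMap v i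
  let δ : Derivation ℤ E (⋀[E]^(m + 1) (Ω[E⁄ℤ])) := lin.compDer (KaehlerDifferential.D ℤ E)
  have hδ : ∀ a, δ a = KahlerWedge E (m + 1) (Function.update v i (KaehlerDifferential.D ℤ E a)) :=
    fun a => rfl
  have hδi : δ (x i) = KahlerWedge E (m + 1) v := by
    rw [hδ]; congr 1; exact Function.update_eq_self i v
  have hδj : ∀ j, j ≠ i → δ (x j) = 0 := by
    intro j hj
    rw [hδ]
    exact (exteriorPower.ιMulti E (m + 1) (M := Ω[E⁄ℤ])).map_update_self v hj.symm
  have hr : ∀ s : Finset (Fin (m + 1)), i ∉ s → δ (∏ j ∈ s, x j ^ J j) = 0 := by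
    intro s
    induction s using Finset.induction_on with
    | empty => intro _; simp
    | insert a s has ih =>
      intro his
      rw [Finset.prod_insert has, Derivation.leibniz, ih (fun h => his (Finset.mem_insert_of_mem h)),
        Derivation.leibniz_pow, hδj a (fun h => his (h ▸ Finset.mem_insert_self _ _))]
      simp
  set r := ∏ j ∈ Finset.univ.erase i, x j ^ J j with hrdef
  have hprod : ∏ j, x j ^ J j = x i ^ J i * r :=
    (Finset.mul_prod_erase _ _ (Finset.mem_univ i)).symm
  have hr0 : δ r = 0 := hr _ (Finset.notMem_erase _ _)
  refine ⟨Function.update x i (((J i + 1 : ℕ) : E)⁻¹ * (y ^ p * (x i ^ (J i + 1) * r))), ?_⟩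
  have e1 : (fun j => KaehlerDifferential.D ℤ E (Function.update x i
      (((J i + 1 : ℕ) : E)⁻¹ * (y ^ p * (x i ^ (J i + 1) * r))) j)) =
      Function.update v i (KaehlerDifferential.D ℤ E
        (((J i + 1 : ℕ) : E)⁻¹ * (y ^ p * (x i ^ (J i + 1) * r)))) := by
    funext j
    by_cases hj : j = i
    · subst hj; simp
    · simp [hj, v]
  rw [e1, ← hδ, Derivation.leibniz, Derivation.leibniz, Derivation.leibniz, hr0, kh_D_pow (p := p) y δ,
    Derivation.leibniz_inv, Derivation.map_natCast, Derivation.leibniz_pow, hδi, hprod,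
    ← Nat.cast_smul_eq_nsmul E]
  simp only [smul_zero, add_zero, zero_add, smul_smul, Nat.add_sub_cancel]
  congr 1
  field_simp

universe u

theorem kh_denom {F : Type*} [Field F] {L : Type*} [Field L] [Algebra F L] {σ : Type*} (x : σ → L)
    {κ : Type*} (s : Finset κ) (c : κ → L)
    (hc : ∀ k ∈ s, c k ∈ IntermediateField.adjoin F (Set.range x)) :
    ∃ h : MvPolynomial σ F, MvPolynomial.aeval x h ≠ 0 ∧
      ∀ k ∈ s, ∃ f : MvPolynomial σ F, MvPolynomial.aeval x h * c k = MvPolynomial.aeval x f := by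
  classical
  induction s using Finset.induction_on with
  | empty => exact ⟨1, by simp, by simp⟩
  | insert a s has ih =>
    obtain ⟨h, hh, hs⟩ := ih (fun k hk => hc k (Finset.mem_insert_of_mem hk))
    obtain ⟨q, t, hqt⟩ := (IntermediateField.mem_adjoin_range_iff F x (c a)).1
      (hc a (Finset.mem_insert_self _ _))
    by_cases ht : MvPolynomial.aeval x t = 0
    · refine ⟨h, hh, fun k hk => ?_⟩
      rcases Finset.mem_insert.1 hk with rfl | hk
      · exact ⟨0, by rw [hqt, ht]; simp⟩
      · exact hs k hk
    · refine ⟨h * t, by rw [map_mul]; exact mul_ne_zero hh ht, fun k hk => ?_⟩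
      rcases Finset.mem_insert.1 hk with rfl | hk
      · exact ⟨h * q, by rw [hqt, map_mul, map_mul]; field_simp⟩
      · obtain ⟨f, hf⟩ := hs k hk
        exact ⟨t * f, by rw [map_mul, map_mul, ← hf]; ring⟩

theorem kh_data {p : ℕ} [Fact p.Prime] {F : Type*} [Field F] [CharP F p]
    {L : Type*} [Field L] [Algebra F L] [Algebra.EssFiniteType F L] {n : ℕ} (x : Fin n → L)
    [hsep : Algebra.IsSeparable (IntermediateField.adjoin F (Set.range x)) L] (a : L) :
    ∃ (m : ℕ) (e : Fin m → L) (h : L) (f : Fin m → Fin m → MvPolynomial (Fin n) F)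
      (g : Fin m → MvPolynomial (Fin n) F), h ≠ 0 ∧
      (∀ j, h ^ (p - 1) * e j = ∑ k, MvPolynomial.aeval x (f j k) * e k ^ p) ∧
      h * a = ∑ j, MvPolynomial.aeval x (g j) * e j := by
  have hp : p.Prime := Fact.out
  let K := IntermediateField.adjoin F (Set.range x)
  have : Algebra.EssFiniteType K L := Algebra.EssFiniteType.of_comp F K L
  have : FiniteDimensional K L := Algebra.finite_of_essFiniteType_of_isAlgebraic
  have : CharP K p := charP_of_injective_algebraMap (algebraMap F K).injective p
  have : ExpChar K p := ExpChar.prime hp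
  let B := Module.finBasis K L
  have hspan := Field.span_map_pow_expChar_pow_eq_top_of_isSeparable p 1 B.span_eq
  have hc : ∀ j, ∃ c : Fin (Module.finrank K L) → K, ∑ k, c k • (B k ^ p ^ 1) = B j := by
    intro j
    have : B j ∈ Submodule.span K (Set.range (fun k => B k ^ p ^ 1)) := by
      rw [hspan]; trivial
    exact (Submodule.mem_span_range_iff_exists_fun K).1 this
  choose c hc using hc
  let m := Module.finrank K L
  obtain ⟨h, hh, H⟩ := kh_denom x (Finset.univ : Finset ((Fin m × Fin m) ⊕ Fin m))
    (fun q => Sum.elim (fun q => (c q.1 q.2 : L)) (fun j => (B.repr a j : L)) q)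
    (by rintro (q | j) _ <;> exact Subtype.property _)
  have H1 : ∀ j k, ∃ f, MvPolynomial.aeval x h * (c j k : L) = MvPolynomial.aeval x f :=
    fun j k => H (Sum.inl (j, k)) (Finset.mem_univ _)
  have H2 : ∀ j, ∃ f, MvPolynomial.aeval x h * (B.repr a j : L) = MvPolynomial.aeval x f :=
    fun j => H (Sum.inr j) (Finset.mem_univ _)
  choose f hf using H1
  choose g hg using H2
  refine ⟨m, B, MvPolynomial.aeval x h, fun j k => h ^ (p - 2) * f j k, g, hh, ?_, ?_⟩
  · intro j
    conv_lhs => rw [← hc j]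
    rw [Finset.mul_sum]
    refine Finset.sum_congr rfl fun k _ => ?_
    have : p - 1 = p - 2 + 1 := by have := hp.two_le; omega
    rw [map_mul, map_pow, ← hf, this, pow_one, IntermediateField.smul_def, smul_eq_mul]
    ring
  · conv_lhs => rw [← B.sum_repr a]
    rw [Finset.mul_sum]
    refine Finset.sum_congr rfl fun k _ => ?_
    rw [← hg, IntermediateField.smul_def, smul_eq_mul]
    ring

open scoped IntermediateField.algebraAdjoinAdjoin in
theorem kh_trdeg {F : Type*} {E : Type u} [Field F] [Field E] [Algebra F E] (s : Finset E) (n : ℕ)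
    (hs : s.card ≤ n) (hE : Algebra.IsAlgebraic (IntermediateField.adjoin F (s : Set E)) E)
    {ι : Type u} [Fintype ι] (t : ι → E) (ht : AlgebraicIndependent F t) :
    Fintype.card ι ≤ n := by
  have h0 : Algebra.IsAlgebraic (Algebra.adjoin F (s : Set E)) E := by
    exact (IsFractionRing.comap_isAlgebraic_iff (A := Algebra.adjoin F (s : Set E))
      (K := IntermediateField.adjoin F (s : Set E)) (C := E)).mpr hE
  have h1 := Algebra.IsAlgebraic.trdeg_le_cardinalMk F (s : Set E)
  have h2 := ht.cardinalMk_le_trdeg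
  have h3 := h2.trans h1
  simp only [Cardinal.mk_fintype, Fintype.card_coe, Finset.coe_sort_coe, Nat.cast_le] at h3
  omega

theorem kh_span {p : ℕ} [Fact p.Prime] {F : Type*} [Field F] [IsAlgClosed F] [CharP F p]
    {E : Type*} [Field E] [Algebra F E] [CharP E p] (L : IntermediateField F E)
    {κ : Type*} (x : κ → L)
    [hsep : Algebra.IsSeparable (IntermediateField.adjoin F (Set.range x)) L] (g : L) :
    KaehlerDifferential.D ℤ E (g : E) ∈
      Submodule.span L (Set.range fun k => KaehlerDifferential.D ℤ E (x k : E)) := by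
  have hp : p.Prime := Fact.out
  set W := Submodule.span L (Set.range fun k => KaehlerDifferential.D ℤ E (x k : E)) with hW
  have hmul : ∀ a b : L, KaehlerDifferential.D ℤ E (a : E) ∈ W →
      KaehlerDifferential.D ℤ E (b : E) ∈ W →
      KaehlerDifferential.D ℤ E ((a * b : L) : E) ∈ W := by
    intro a b ha hb
    have : KaehlerDifferential.D ℤ E ((a * b : L) : E)
        = a • KaehlerDifferential.D ℤ E (b : E) + b • KaehlerDifferential.D ℤ E (a : E) :=
      Derivation.leibniz _ _ _
    rw [this]
    exact W.add_mem (W.smul_mem _ hb) (W.smul_mem _ ha)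
  have hadd : ∀ a b : L, KaehlerDifferential.D ℤ E (a : E) ∈ W →
      KaehlerDifferential.D ℤ E (b : E) ∈ W →
      KaehlerDifferential.D ℤ E ((a + b : L) : E) ∈ W := by
    intro a b ha hb
    have : KaehlerDifferential.D ℤ E ((a + b : L) : E)
        = KaehlerDifferential.D ℤ E (a : E) + KaehlerDifferential.D ℤ E (b : E) :=
      map_add _ _ _
    rw [this]
    exact W.add_mem ha hb
  have hpow : ∀ a : L, KaehlerDifferential.D ℤ E ((a ^ p : L) : E) ∈ W := by
    intro a
    have : KaehlerDifferential.D ℤ E ((a ^ p : L) : E) = 0 := kh_D_pow (a : E) _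
    rw [this]; exact W.zero_mem
  have hK : ∀ k ∈ IntermediateField.adjoin F (Set.range x),
      KaehlerDifferential.D ℤ E (k : E) ∈ W := by
    intro k hk
    induction hk using IntermediateField.adjoin_induction with
    | mem y hy =>
      obtain ⟨i, rfl⟩ := hy
      exact Submodule.subset_span ⟨i, rfl⟩
    | algebraMap c =>
      obtain ⟨d, rfl⟩ := IsAlgClosed.exists_pow_nat_eq c hp.pos
      rw [map_pow]; exact hpow _
    | add a b _ _ ha hb => exact hadd a b ha hb
    | mul a b _ _ ha hb => exact hmul a b ha hb
    | inv a _ ha =>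
      have : KaehlerDifferential.D ℤ E ((a⁻¹ : L) : E)
          = (-a⁻¹ ^ 2 : L) • KaehlerDifferential.D ℤ E (a : E) := Derivation.leibniz_inv _ _
      rw [this]; exact W.smul_mem _ ha
  let K := IntermediateField.adjoin F (Set.range x)
  have : CharP K p := charP_of_injective_algebraMap (algebraMap F K).injective p
  have : ExpChar K p := ExpChar.prime hp
  have hspan := Field.span_map_pow_expChar_pow_eq_top_of_isSeparable (F := K) (E := L)
    (v := fun a : L => a) p 1 (by simp)
  have hg : g ∈ Submodule.span K (Set.range fun a : L => a ^ p ^ 1) := by rw [hspan]; trivial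
  induction hg using Submodule.span_induction with
  | mem y hy => obtain ⟨a, rfl⟩ := hy; simpa using hpow a
  | zero => simp
  | add a b _ _ ha hb => exact hadd a b ha hb
  | smul c a _ ha => exact hmul (c : L) a (hK _ c.2) ha

theorem kh_main (p : ℕ) [Fact p.Prime]
    (F : Type*) [Field F] [IsAlgClosed F] [CharP F p]
    (E : Type*) [Field E] [Algebra F E] [CharP E p] {n : ℕ} (s : Finset E) (hs : s.card ≤ n)
    (hE : Algebra.IsAlgebraic (IntermediateField.adjoin F (s : Set E)) E)
    (g : Fin n → E) (a : E) :
    a • exteriorPower.ιMulti E n (fun i => KaehlerDifferential.D ℤ E (g i)) ∈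
      exactSubgroup E n ⊔ artinSchreierSubgroup p E n := by
  classical
  let L : IntermediateField F E := IntermediateField.adjoin F (insert a (Set.range g))
  have hL : Algebra.EssFiniteType F L :=
    IntermediateField.essFiniteType_iff.2
      ⟨((Set.finite_range g).insert a).toFinset, by simp [L]⟩
  have haL : a ∈ L := IntermediateField.subset_adjoin _ _ (Set.mem_insert _ _)
  have hgL : ∀ i, g i ∈ L := fun i =>
    IntermediateField.subset_adjoin _ _ (Set.mem_insert_of_mem _ ⟨i, rfl⟩)
  obtain ⟨t, ht, hsep⟩ := exists_isTranscendenceBasis_and_isSeparable_of_perfectField F L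
  have hcard : Fintype.card t ≤ n := kh_trdeg s n hs hE (fun i : t => ((i : L) : E))
    (ht.1.map' (f := L.val) L.val.injective)
  have hsep' : ∀ {κ : Type _} (x : κ → L), Set.range x = (t : Set L) →
      Algebra.IsSeparable (IntermediateField.adjoin F (Set.range x)) L := by
    intro κ x hx; rw [hx]; exact hsep
  have hc : ∀ i, ∃ c : t → L, ∑ k, c k • KaehlerDifferential.D ℤ E ((k : L) : E)
      = KaehlerDifferential.D ℤ E (g i) := by
    intro i
    have := hsep' (fun k : t => (k : L)) (by simp)
    exact (Submodule.mem_span_range_iff_exists_fun L).1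
      (kh_span (p := p) L (fun k : t => (k : L)) ⟨g i, hgL i⟩)
  choose c hc using hc
  have hexp : exteriorPower.ιMulti E n (fun i => KaehlerDifferential.D ℤ E (g i)) =
      ∑ f : Fin n → t, (∏ i, (c i (f i) : E)) •
        exteriorPower.ιMulti E n (fun i => KaehlerDifferential.D ℤ E (((f i : t) : L) : E)) := by
    have e1 : (fun i => KaehlerDifferential.D ℤ E (g i)) =
        fun i => ∑ k : t, (c i k : E) • KaehlerDifferential.D ℤ E ((k : L) : E) := by
      funext i; rw [← hc i]; rfl
    rw [e1]
    refine ((exteriorPower.ιMulti E n (M := Ω[E⁄ℤ])).toMultilinearMap.map_sum _).trans ?_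
    refine Finset.sum_congr rfl fun f _ => ?_
    exact (exteriorPower.ιMulti E n (M := Ω[E⁄ℤ])).toMultilinearMap.map_smul_univ _ _
  rw [hexp, Finset.smul_sum]
  refine AddSubgroup.sum_mem _ fun f _ => ?_
  by_cases hf : Function.Injective f
  swap
  · rw [AlternatingMap.map_eq_zero_of_not_injective, smul_zero, smul_zero]
    · exact AddSubgroup.zero_mem _
    · intro hinj
      apply hf
      intro i j hij
      apply hinj
      simp only [hij]
  have hbij : Function.Bijective f := by
    rw [Fintype.bijective_iff_injective_and_card]
    refine ⟨hf, ?_⟩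
    have := Fintype.card_le_of_injective f hf
    rw [Fintype.card_fin] at this ⊢
    omega
  let x : Fin n → L := fun i => (f i : L)
  have hxr : Set.range x = (t : Set L) := by
    have : x = Subtype.val ∘ f := rfl
    rw [this, Set.range_comp, hbij.2.range_eq]
    simp
  have hx0 : ∀ i, (x i : E) ≠ 0 := by
    intro i h0
    exact ht.1.ne_zero (f i) (by exact_mod_cast h0)
  have : Algebra.IsSeparable (IntermediateField.adjoin F (Set.range x)) L := by
    rw [hxr]; exact hsep
  let b : L := ⟨a, haL⟩ * ∏ i, c i (f i)
  obtain ⟨m, e, h, q, r, hh, hq, hr⟩ := kh_data (p := p) (F := F) x b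
  have hae : ∀ P : MvPolynomial (Fin n) F,
      ((MvPolynomial.aeval x P : L) : E) = MvPolynomial.aeval (fun i => (x i : E)) P := by
    intro P
    exact (MvPolynomial.comp_aeval_apply (R := F) x L.val P)
  have hfin := kh_abs (p := p) (F := F) (khPhi p (fun i => (x i : E))) (fun i => (x i : E))
    (khPhi_h1 p _ hx0) (khPhi_h2 p _) (fun j => (e j : E)) (h : E) (by exact_mod_cast hh) q
    (by
      intro j
      have := congrArg L.val (hq j)
      rw [map_sum] at this
      simp only [map_mul, map_pow, IntermediateField.coe_val, hae] at this
      exact this) (b : E) r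
    (by
      have := congrArg L.val hr
      rw [map_sum] at this
      simp only [map_mul, IntermediateField.coe_val, hae] at this
      exact this)
  rw [khPhi_apply, QuotientAddGroup.eq_zero_iff] at hfin
  rw [smul_smul]
  have hb : (b : E) = a * ∏ i, (c i (f i) : E) := by
    have : (b : E) = L.val (⟨a, haL⟩ * ∏ i, c i (f i)) := rfl
    rw [this, map_mul, map_prod]; rfl
  rw [← hb]
  exact hfin

/-- If `F` is an algebraically closed field of characteristic `p > 0` and `E/F`
is a field extension with `trdeg_F E ≤ n`, then `H^{n+1}_p(E) = 0`. -/
theorem katoH_eq_zero_of_trdeg_le (p : ℕ) [Fact p.Prime]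
    (F : Type*) [Field F] [IsAlgClosed F] [CharP F p]
    (E : Type*) [Field E] [Algebra F E] (n : ℕ) (h : TrdegLE F E n) :
    ∀ x : KatoH p E n, x = 0 := by
  have hp : p.Prime := Fact.out
  have hchar : CharP E p := charP_of_injective_algebraMap (algebraMap F E).injective p
  obtain ⟨s, hs, hE⟩ := h
  have key : ∀ ω : ⋀[E]^n (Ω[E⁄ℤ]), ∀ a : E,
      a • ω ∈ exactSubgroup E n ⊔ artinSchreierSubgroup p E n := by
    intro ω
    have hω : ω ∈ Submodule.span E (exteriorPower.ιMulti E n ''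
        {v : Fin n → Ω[E⁄ℤ] | Set.range v ⊆ Set.range (KaehlerDifferential.D ℤ E)}) := by
      rw [exteriorPower.ιMulti_span_of_span E n _ (KaehlerDifferential.span_range_derivation ℤ E)]
      trivial
    induction hω using Submodule.span_induction with
    | zero => intro a; rw [smul_zero]; exact AddSubgroup.zero_mem _
    | add u v _ _ hu hv => intro a; rw [smul_add]; exact AddSubgroup.add_mem _ (hu a) (hv a)
    | smul c u _ hu => intro a; rw [smul_smul]; exact hu _
    | mem u hu =>
      intro a
      obtain ⟨v, hv, rfl⟩ := hu
      have hv' : ∀ i, ∃ g, KaehlerDifferential.D ℤ E g = v i := fun i => hv ⟨i, rfl⟩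
      choose g hg using hv'
      obtain rfl : (fun i => KaehlerDifferential.D ℤ E (g i)) = v := funext hg
      exact kh_main p F E s hs hE g a
  intro x
  obtain ⟨ω, rfl⟩ := QuotientAddGroup.mk_surjective x
  rw [QuotientAddGroup.eq_zero_iff]
  simpa using key ω 1

end
end

section
/- Let F̄ be an algebraically closed field of characteristic 2 and let L = F̄(x₁, …, xₙ) be the rational function field in n independent variables. Then the n-fold quadratic Pfister form ⟨⟨x₁, …, x_{n−1}, xₙ]] is anisotropic over L. -/
/-!
Statement 2: Let `F` be an algebraically closed field of characteristic `2` and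
`L = F(x₁, …, xₙ)` the rational function field in `n` independent variables.  Then the `n`-fold
quadratic Pfister form `⟨⟨x₁, …, x_{n−1}, xₙ]]` is anisotropic over `L`.
-/

noncomputable section

/-- The Gram matrix of the `(m+1)`-fold quadratic Pfister form
`⟨⟨a₁, …, a_m, b]] = ⟨1,a₁⟩ ⊗ ⋯ ⊗ ⟨1,a_m⟩ ⊗ [1,b]` in its natural basis: it is the orthogonal
sum, over the subsets `S ⊆ {1,…,m}` (encoded as `S : Fin m → Bool`), of the binary forms
`c_S · [1, b]` with `c_S = ∏_{i ∈ S} a_i`, where `[1,b]` is the binary quadratic form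
`(x, y) ↦ x² + xy + by²`. -/
def pfisterMatrix {K : Type*} [Field K] {m : ℕ} (a : Fin m → K) (b : K) :
    Matrix ((Fin m → Bool) × Bool) ((Fin m → Bool) × Bool) K :=
  fun r c =>
    if r.1 = c.1 then
      (∏ i, if r.1 i then a i else 1) *
        (if r.2 then (if c.2 then b else 0) else 1)
    else 0

/-- The `(m+1)`-fold quadratic Pfister form
`⟨⟨a₁, …, a_m, b]] = ⟨1,a₁⟩ ⊗ ⋯ ⊗ ⟨1,a_m⟩ ⊗ [1,b]`, as a quadratic form in `2^(m+1)`
variables given by `v ↦ vᵀ M v` for its Gram matrix `M`. -/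
def quadPfister {K : Type*} [Field K] {m : ℕ} (a : Fin m → K) (b : K) :
    QuadraticForm K (((Fin m → Bool) × Bool) → K) :=
  (pfisterMatrix a b).toQuadraticMap'

namespace PfisterAux

open MvPolynomial

variable {σ F : Type*} [Field F]

lemma add_ne_zero_of_lt (m : MonomialOrder σ) {f g : MvPolynomial σ F}
    (h : m.toSyn (m.degree g) < m.toSyn (m.degree f)) : f + g ≠ 0 := by
  intro h0
  have : f = -g := eq_neg_of_add_eq_zero_left h0
  rw [this, m.degree_neg] at h
  exact lt_irrefl _ h

lemma main_lt (m : MonomialOrder σ) {f g h : MvPolynomial σ F}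
    (h1 : m.toSyn (m.degree g) < m.toSyn (m.degree f))
    (h2 : m.toSyn (m.degree h) < m.toSyn (m.degree f)) :
    f + (g + h) ≠ 0 ∧ m.degree (f + (g + h)) = m.degree f := by
  have : m.toSyn (m.degree (g + h)) < m.toSyn (m.degree f) :=
    lt_of_le_of_lt m.degree_add_le (max_lt h1 h2)
  exact ⟨add_ne_zero_of_lt m this, m.degree_add_of_lt this⟩

lemma binary (m : MonomialOrder σ) (j : σ) (u w : MvPolynomial σ F) (h : u ≠ 0 ∨ w ≠ 0) :
    u * u + u * w + X j * (w * w) ≠ 0 ∧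
      ∀ i, i ≠ j → 2 ∣ m.degree (u * u + u * w + X j * (w * w)) i := by
  classical
  have hX : (X j : MvPolynomial σ F) ≠ 0 := X_ne_zero j
  have hdu : u ≠ 0 → m.degree (u * u) = m.degree u + m.degree u := fun hu => m.degree_mul hu hu
  have hdw : w ≠ 0 → m.degree (X j * (w * w)) =
      Finsupp.single j 1 + (m.degree w + m.degree w) := fun hw => by
    rw [m.degree_mul hX (mul_ne_zero hw hw), m.degree_mul hw hw, m.degree_X]
  have pu : u ≠ 0 → ∀ i, i ≠ j → 2 ∣ m.degree (u * u) i := fun hu i _ => by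
    rw [hdu hu, Finsupp.add_apply]; omega
  have pw : w ≠ 0 → ∀ i, i ≠ j → 2 ∣ m.degree (X j * (w * w)) i := fun hw i hi => by
    rw [hdw hw, Finsupp.add_apply, Finsupp.add_apply, Finsupp.single_apply, if_neg hi.symm]; omega
  by_cases hu : u = 0
  · have hw : w ≠ 0 := by tauto
    subst hu
    simp only [zero_mul, zero_add]
    exact ⟨mul_ne_zero hX (mul_ne_zero hw hw), pw hw⟩
  by_cases hw : w = 0
  · subst hw
    simp only [mul_zero, add_zero]
    exact ⟨mul_ne_zero hu hu, pu hu⟩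
  have hduw : m.degree (u * w) = m.degree u + m.degree w := m.degree_mul hu hw
  have e0 : 0 < m.toSyn (Finsupp.single j 1) := by
    rw [m.toSyn_lt_iff_ne_zero]
    simp
  rcases lt_trichotomy (m.toSyn (m.degree (u * u))) (m.toSyn (m.degree (X j * (w * w))))
    with hlt | heq | hlt
  · have hc : m.toSyn (m.degree (u * w)) < m.toSyn (m.degree (X j * (w * w))) := by
      have hlt' := hlt
      rw [hdu hu, hdw hw] at hlt'
      rw [hduw, hdw hw]
      simp only [map_add] at hlt' ⊢
      rw [← add_assoc]
      refine add_lt_add_of_lt_of_le ?_ le_rfl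
      by_contra hcon
      have hcon := not_lt.mp hcon
      have h2 := add_le_add hcon hcon
      refine absurd (lt_of_le_of_lt h2 hlt') (not_lt.mpr ?_)
      rw [add_assoc]
      refine add_le_add le_rfl ?_
      refine add_le_add le_rfl ?_
      exact le_add_of_nonneg_left e0.le
    have := main_lt m hlt hc
    rw [show u * u + u * w + X j * (w * w) = X j * (w * w) + (u * u + u * w) by ring]
    rw [this.2]
    exact ⟨this.1, pw hw⟩
  · exfalso
    have := DFunLike.congr_fun (m.toSyn.injective heq) j
    rw [hdu hu, hdw hw] at this
    simp at this
    omega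
  · have hc : m.toSyn (m.degree (u * w)) < m.toSyn (m.degree (u * u)) := by
      have hlt' := hlt
      rw [hdu hu, hdw hw] at hlt'
      rw [hduw, hdu hu]
      simp only [map_add] at hlt' ⊢
      refine add_lt_add_of_le_of_lt le_rfl ?_
      by_contra hcon
      have hcon := not_lt.mp hcon
      refine absurd hlt' (not_lt.mpr ?_)
      exact (add_le_add hcon hcon).trans (le_add_of_nonneg_left e0.le)
    have := main_lt m hc hlt
    rw [show u * u + u * w + X j * (w * w) = u * u + (u * w + X j * (w * w)) by ring]
    rw [this.2]
    exact ⟨this.1, pu hu⟩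

lemma sum_ne_zero (m : MonomialOrder σ) {ι : Type*} [Fintype ι] (p : ι → MvPolynomial σ F)
    (hne : ∃ s, p s ≠ 0)
    (hinj : ∀ s t, p s ≠ 0 → p t ≠ 0 → m.degree (p s) = m.degree (p t) → s = t) :
    ∑ s, p s ≠ 0 := by
  classical
  obtain ⟨s0, hs0⟩ := hne
  obtain ⟨s, hs, hmax⟩ := Finset.exists_max_image (Finset.univ.filter fun s => p s ≠ 0)
    (fun s => m.toSyn (m.degree (p s))) ⟨s0, by simpa using hs0⟩
  have hs' : p s ≠ 0 := by simpa using hs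
  intro h0
  have hc := congrArg (coeff (m.degree (p s))) h0
  rw [coeff_sum, Finset.sum_eq_single s, coeff_zero] at hc
  · exact m.coeff_degree_ne_zero_iff.mpr hs' hc
  · intro t _ hts
    by_cases ht : p t = 0
    · rw [ht, coeff_zero]
    · apply m.coeff_eq_zero_of_lt
      refine lt_of_le_of_ne (hmax t (by simpa using ht)) fun he => hts ?_
      exact hinj t s ht hs' (m.toSyn.injective he)
  · simp

lemma poly (m : MonomialOrder σ) {k : ℕ} (a : Fin k → σ) (ha : Function.Injective a) (j : σ)
    (hj : ∀ i, a i ≠ j) (v : ((Fin k → Bool) × Bool) → MvPolynomial σ F)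
    (h0 : ∑ S : Fin k → Bool, (∏ i, if S i then X (a i) else 1) *
      (v (S, false) * v (S, false) + v (S, false) * v (S, true) +
        X j * (v (S, true) * v (S, true))) = 0) : v = 0 := by
  classical
  have hc : ∀ S : Fin k → Bool, (∏ i, if S i then X (a i) else 1 : MvPolynomial σ F) ≠ 0 := by
    intro S
    rw [Finset.prod_ne_zero_iff]
    intro i _
    split_ifs
    · exact X_ne_zero _
    · exact one_ne_zero
  have hdc : ∀ (S : Fin k → Bool) (i : Fin k),
      m.degree (∏ i, if S i then X (a i) else 1 : MvPolynomial σ F) (a i) =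
        if S i then 1 else 0 := by
    intro S i
    rw [m.degree_prod, Finsupp.finsetSum_apply, Finset.sum_eq_single i]
    · split_ifs <;> simp [m.degree_X, m.degree_one]
    · intro b _ hb
      split_ifs
      · rw [m.degree_X, Finsupp.single_apply, if_neg (fun h => hb (ha h))]
      · simp [m.degree_one]
    · simp
    · intro i _
      split_ifs
      · exact X_ne_zero _
      · exact one_ne_zero
  by_contra hv
  refine sum_ne_zero m _ ?_ ?_ h0
  · obtain ⟨⟨S, b⟩, hS⟩ := Function.ne_iff.mp hv
    refine ⟨S, mul_ne_zero (hc S) (binary m j _ _ ?_).1⟩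
    cases b
    · exact Or.inl hS
    · exact Or.inr hS
  · have key : ∀ (S : Fin k → Bool), (∏ i, if S i then X (a i) else 1) *
      (v (S, false) * v (S, false) + v (S, false) * v (S, true) +
        X j * (v (S, true) * v (S, true))) ≠ 0 → ∀ i, 
        m.degree ((∏ i, if S i then X (a i) else 1) *
      (v (S, false) * v (S, false) + v (S, false) * v (S, true) +
        X j * (v (S, true) * v (S, true)))) (a i) % 2 = if S i then 1 else 0 := by
      intro S hS i
      have h2 := right_ne_zero_of_mul hS
      have hor : v (S, false) ≠ 0 ∨ v (S, true) ≠ 0 := by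
        by_contra hcon
        push Not at hcon
        rw [hcon.1, hcon.2] at h2
        simp at h2
      have hb := (binary m j _ _ hor).2 (a i) (hj i)
      rw [m.degree_mul (hc S) h2, Finsupp.add_apply, hdc]
      split_ifs <;> omega
    intro S T hS hT hST
    funext i
    have h1 := key S hS i
    have h2 := key T hT i
    rw [hST, h2] at h1
    revert h1
    cases S i <;> cases T i <;> simp

end PfisterAux

lemma PfisterAux.quadPfister_apply {K : Type*} [Field K] {m : ℕ} (a : Fin m → K) (b : K)
    (v : ((Fin m → Bool) × Bool) → K) :
    quadPfister a b v = ∑ S : Fin m → Bool, (∏ i, if S i then a i else 1) *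
      (v (S, false) * v (S, false) + v (S, false) * v (S, true) +
        b * (v (S, true) * v (S, true))) := by
  have h : quadPfister a b v = ∑ r, ∑ c, v r * (pfisterMatrix a b r c) * v c := by
    change Matrix.toLinearMap₂' K (pfisterMatrix a b) v v = _
    simp [Matrix.toLinearMap₂'_apply, mul_comm, mul_left_comm]
  rw [h, Fintype.sum_prod_type]
  refine Finset.sum_congr rfl fun S _ => ?_
  have h2 : ∀ b' : Bool, ∑ c, v (S, b') * (pfisterMatrix a b (S, b') c) * v c =
      ∑ c' : Bool, v (S, b') * (pfisterMatrix a b (S, b') (S, c')) * v (S, c') := by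
    intro b'
    rw [Fintype.sum_prod_type, Finset.sum_eq_single S]
    · intro T _ hT
      refine Finset.sum_eq_zero fun c' _ => ?_
      simp [pfisterMatrix, hT.symm]
    · simp
  simp only [h2, Fintype.sum_bool]
  simp [pfisterMatrix]
  ring

/-- Over the rational function field `L = F(x₁,…,xₙ)` in `n` variables over an
algebraically closed field `F` of characteristic `2`, the `n`-fold quadratic Pfister form
`⟨⟨x₁, …, x_{n−1}, xₙ]]` is anisotropic. -/
theorem quadPfister_anisotropic_of_variables (F : Type*) [Field F] [IsAlgClosed F] [CharP F 2]
    (n : ℕ) (hn : 1 ≤ n)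
    (L : Type*) [Field L] [Algebra (MvPolynomial (Fin n) F) L]
    [IsFractionRing (MvPolynomial (Fin n) F) L]
    (x : Fin n → L) (hx : ∀ i, x i = algebraMap (MvPolynomial (Fin n) F) L (MvPolynomial.X i)) :
    (quadPfister (fun i : Fin (n - 1) => x (Fin.castLE (n.sub_le 1) i))
        (x ⟨n - 1, by omega⟩)).Anisotropic := by
  obtain ⟨k, rfl⟩ : ∃ k, n = k + 1 := ⟨n - 1, by omega⟩
  intro v hv
  obtain ⟨d, hd⟩ := IsLocalization.exist_integer_multiples_of_finite
    (nonZeroDivisors (MvPolynomial (Fin (k + 1)) F)) v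
  choose w hw using hd
  have hd0 : algebraMap (MvPolynomial (Fin (k + 1)) F) L d ≠ 0 :=
    IsFractionRing.to_map_ne_zero_of_mem_nonZeroDivisors d.2
  rw [PfisterAux.quadPfister_apply] at hv
  have hw0 : w = 0 := by
    refine PfisterAux.poly MonomialOrder.lex (fun i : Fin k => Fin.castSucc i)
      (Fin.castSucc_injective k) (Fin.last k) (fun i => (Fin.castSucc_lt_last i).ne) w ?_
    apply IsFractionRing.injective (MvPolynomial (Fin (k + 1)) F) L
    rw [map_zero, map_sum]
    have h2 := congrArg (fun z => algebraMap (MvPolynomial (Fin (k + 1)) F) L d *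
      algebraMap (MvPolynomial (Fin (k + 1)) F) L d * z) hv
    simp only [mul_zero, Finset.mul_sum] at h2
    rw [← h2]
    refine Finset.sum_congr rfl fun S _ => ?_
    simp only [map_mul, map_add, map_prod, hw, Algebra.smul_def, hx]
    have : ∀ i : Fin k, algebraMap (MvPolynomial (Fin (k + 1)) F) L
        (if S i then MvPolynomial.X (Fin.castSucc i) else 1) =
        if S i then algebraMap (MvPolynomial (Fin (k + 1)) F) L
          (MvPolynomial.X (Fin.castSucc i)) else 1 := by
      intro i
      split_ifs <;> simp
    rw [Finset.prod_congr rfl fun i _ => this i]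
    have hl : (⟨k + 1 - 1, by omega⟩ : Fin (k + 1)) = Fin.last k := rfl
    have hcs : ∀ i : Fin k, Fin.castLE ((k + 1).sub_le 1) i = Fin.castSucc i := fun i => rfl
    simp only [hl]
    change _ = _ * _ * ((∏ i : Fin k, if S i then algebraMap (MvPolynomial (Fin (k + 1)) F) L
          (MvPolynomial.X (Fin.castSucc i)) else 1) * _)
    ring
  funext s
  have h3 := hw s
  rw [hw0, Pi.zero_apply, map_zero, Algebra.smul_def] at h3
  exact (mul_eq_zero.mp h3.symm).resolve_left hd0

end
end

section
/- Let F̄ be an algebraically closed field of characteristic 2 and L = F̄(x₁, …, xₙ) the rational function field in n independent variables. Then the class of the differential form xₙ · (dx₁/x₁) ∧ ⋯ ∧ (dx_{n−1}/x_{n−1}) is nonzero in Kato's cohomology group H^n_2(L). -/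
/-!
Statement 3: Let `F` be an algebraically closed field of characteristic `2` and
`L = F(x₁, …, xₙ)` the rational function field in `n` independent variables.  Then the class of
the differential form `xₙ · (dx₁/x₁) ∧ ⋯ ∧ (dx_{n−1}/x_{n−1})` is nonzero in Kato's cohomology
group `H^n_2(L)` (the cokernel of `℘ : Ω^{n-1}_L → Ω^{n-1}_L / dΩ^{n-2}_L`).
-/

noncomputable section

section helpers
open Finset
set_option linter.unusedSectionVars false

/-- abstract grading by `(ℤ/2)^m` -/
structure KGr (H : Type*) [CommRing H] (m : ℕ) where
  A : (Fin m → ZMod 2) → AddSubgroup H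
  one_mem : (1 : H) ∈ A 0
  mul_mem : ∀ {a b : Fin m → ZMod 2} {f g : H}, f ∈ A a → g ∈ A b → f * g ∈ A (a + b)
  p : (Fin m → ZMod 2) → H →+ H
  p_mem : ∀ a f, p a f ∈ A a
  p_sum : ∀ f, ∑ a, p a f = f
  p_of_mem : ∀ {a f}, f ∈ A a → p a f = f
  p_of_ne : ∀ {a b f}, f ∈ A a → a ≠ b → p b f = 0

namespace KGr
variable {H : Type*} [Field H] [CharP H 2] {m : ℕ} (G : KGr H m)

noncomputable def φ (H : Type*) [Field H] [CharP H 2] : ZMod 2 →+* H := ZMod.castHom (dvd_refl 2) H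

noncomputable def D (j : Fin m) : H →+ H :=
  ∑ a : Fin m → ZMod 2, (AddMonoidHom.mulLeft (φ H (a j))).comp (G.p a)

lemma D_apply (j : Fin m) (f : H) : G.D j f = ∑ a : Fin m → ZMod 2, φ H (a j) * G.p a f := by
  simp [D]

lemma D_of_mem (j : Fin m) {a : Fin m → ZMod 2} {f : H} (hf : f ∈ G.A a) :
    G.D j f = φ H (a j) * f := by
  rw [D_apply, Finset.sum_eq_single a]
  · rw [G.p_of_mem hf]
  · intro b _ hb
    rw [G.p_of_ne hf hb.symm, mul_zero]
  · simp

lemma D_mul (j : Fin m) (f g : H) : G.D j (f * g) = f * G.D j g + g * G.D j f := by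
  conv_lhs => rw [← G.p_sum f, ← G.p_sum g, Finset.sum_mul_sum]
  conv_rhs => rw [G.D_apply, G.D_apply]
  have e1 : f * ∑ a, φ H (a j) * G.p a g = ∑ b, ∑ a, G.p b f * (φ H (a j) * G.p a g) := by
    rw [← Finset.sum_mul_sum, G.p_sum]
  have e2 : g * ∑ a, φ H (a j) * G.p a f = ∑ b, ∑ a, G.p a g * (φ H (b j) * G.p b f) := by
    rw [Finset.sum_comm, ← Finset.sum_mul_sum, G.p_sum]
  rw [e1, e2, map_sum, ← Finset.sum_add_distrib]
  refine Finset.sum_congr rfl fun b _ => ?_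
  rw [map_sum, ← Finset.sum_add_distrib]
  refine Finset.sum_congr rfl fun a _ => ?_
  rw [G.D_of_mem j (G.mul_mem (G.p_mem b f) (G.p_mem a g))]
  simp only [Pi.add_apply, map_add]
  ring

lemma two0 : (2 : H) = 0 := CharTwo.two_eq_zero

lemma cartier (u : H) : ∃ g : H, ∀ j, u * G.D j u = (G.D j u) ^ 2 + G.D j g := by
  have key : ∀ s : Finset (Fin m → ZMod 2), ∃ g : H, ∀ j,
      (∑ a ∈ s, G.p a u) * G.D j (∑ a ∈ s, G.p a u) =
        (G.D j (∑ a ∈ s, G.p a u)) ^ 2 + G.D j g := by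
    classical
    intro s
    induction s using Finset.induction_on with
    | empty => exact ⟨0, by simp⟩
    | insert a s ha ih =>
      obtain ⟨g, hg⟩ := ih
      rw [Finset.sum_insert ha]
      set v := ∑ a ∈ s, G.p a u
      refine ⟨g + G.p a u * v, fun j => ?_⟩
      rw [map_add, map_add, D_mul]
      have h1 : (G.D j (G.p a u))^2 = G.p a u * G.D j (G.p a u) := by
        rw [G.D_of_mem j (G.p_mem a u)]
        have : φ H (a j) * φ H (a j) = φ H (a j) := by
          rw [← map_mul]; congr 1; generalize a j = z; revert z; decide
        linear_combination (G.p a u)^2 * this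
      linear_combination hg j - h1 - (G.D j (G.p a u) * G.D j v) * (two0 (H := H))
  simpa [G.p_sum] using key Finset.univ

lemma sq_mem (f : H) : f ^ 2 ∈ G.A 0 := by
  have : f ^ 2 = ∑ a, (G.p a f) ^ 2 := by
    conv_lhs => rw [← G.p_sum f]
    exact sum_pow_char 2 _ _
  rw [this]
  refine sum_mem fun a _ => ?_
  have := G.mul_mem (G.p_mem a f) (G.p_mem a f)
  rwa [← pow_two, show a + a = 0 from by
    funext j; simp only [Pi.add_apply, Pi.zero_apply]; generalize a j = z; revert z; decide] at this

lemma p0_mul {s : H} (hs : s ∈ G.A 0) (f : H) : G.p 0 (s * f) = s * G.p 0 f := by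
  conv_lhs => rw [← G.p_sum f, Finset.mul_sum, map_sum]
  rw [Finset.sum_eq_single 0]
  · apply G.p_of_mem
    simpa using G.mul_mem hs (G.p_mem 0 f)
  · intro b _ hb
    have := G.mul_mem hs (G.p_mem b f)
    rw [zero_add] at this
    exact G.p_of_ne this hb
  · simp

lemma prod_mem' {ι : Type*} (s : Finset ι) (c : ι → H) (r : ι → Fin m → ZMod 2)
    (h : ∀ i ∈ s, c i ∈ G.A (r i)) : ∏ i ∈ s, c i ∈ G.A (∑ i ∈ s, r i) := by
  classical
  induction s using Finset.induction_on with
  | empty => simpa using G.one_mem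
  | insert a s ha ih =>
    rw [Finset.prod_insert ha, Finset.sum_insert ha]
    exact G.mul_mem (h a (by simp)) (ih fun i hi => h i (by simp [hi]))

def sub0 : Subring H where
  carrier := G.A 0
  mul_mem' := fun ha hb => by simpa using G.mul_mem ha hb
  one_mem' := G.one_mem
  add_mem' := fun ha hb => add_mem ha hb
  zero_mem' := zero_mem _
  neg_mem' := fun ha => neg_mem ha

lemma det_mem (M : Matrix (Fin m) (Fin m) H) (h : ∀ i j, M i j ∈ G.A 0) : M.det ∈ G.A 0 := by
  rw [Matrix.det_apply]
  change _ ∈ G.sub0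
  refine sum_mem fun σ _ => ?_
  refine Subring.zsmul_mem _ ?_ _
  exact prod_mem fun i _ => h _ _

lemma φ_mem (z : ZMod 2) : φ H z ∈ G.A 0 := by
  change _ ∈ G.sub0
  have : z = 0 ∨ z = 1 := by revert z; decide
  rcases this with rfl | rfl
  · rw [map_zero]; exact zero_mem _
  · rw [map_one]; exact one_mem _

/-- mixed determinant lemma -/
lemma p0_det (s : Finset (Fin m)) (hs : s.Nonempty) (g : Fin m → H)
    (M : Matrix (Fin m) (Fin m) H) (h1 : ∀ i ∈ s, ∀ j, M i j = G.D j (g i))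
    (h2 : ∀ i ∉ s, ∀ j, M i j ∈ G.A 0) : G.p 0 M.det = 0 := by
  classical
  let c : Fin m → (Fin m → ZMod 2) → H := fun i a =>
    if i ∈ s then G.p a (g i) else if a = 0 then 1 else 0
  let v : Fin m → (Fin m → ZMod 2) → (Fin m → H) := fun i a =>
    if i ∈ s then fun j => φ H (a j) else M i
  have hM : M = fun i => ∑ a, c i a • v i a := by
    funext i j
    rw [Finset.sum_apply]
    by_cases hi : i ∈ s
    · simp only [c, v, hi, if_true, Pi.smul_apply, smul_eq_mul]
      rw [h1 i hi, G.D_apply]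
      exact Finset.sum_congr rfl fun a _ => mul_comm _ _
    · simp [c, v, hi]
  have hd : M.det = ∑ r : Fin m → (Fin m → ZMod 2), (∏ i, c i (r i)) *
      Matrix.det (fun i => v i (r i)) := by
    conv_lhs => rw [hM]
    have := (Matrix.detRowAlternating (n := Fin m) (R := H)).toMultilinearMap.map_sum
      (fun i a => c i a • v i a)
    refine this.trans (Finset.sum_congr rfl fun r _ => ?_)
    exact (Matrix.detRowAlternating (n := Fin m) (R := H)).toMultilinearMap.map_smul_univ
      (fun i => c i (r i)) (fun i => v i (r i))
  rw [hd, map_sum]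
  refine Finset.sum_eq_zero fun r _ => ?_
  by_cases hr : ∀ i ∉ s, r i = 0
  swap
  · push Not at hr
    obtain ⟨i, hi, hri⟩ := hr
    rw [Finset.prod_eq_zero (Finset.mem_univ i) (by simp [c, hi, hri]), zero_mul, map_zero]
  have hv : Matrix.det (fun i => v i (r i)) ∈ G.A 0 := by
    apply G.det_mem
    intro i j
    by_cases hi : i ∈ s
    · simp only [v, hi, if_true]; exact G.φ_mem _
    · simp only [v, hi, if_false]; exact h2 i hi j
  have hc : ∏ i, c i (r i) ∈ G.A (∑ i, r i) := by
    apply G.prod_mem'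
    intro i _
    by_cases hi : i ∈ s
    · simp only [c, hi, if_true]; exact G.p_mem _ _
    · simp only [c, hi, if_false, hr i hi, if_true]; exact G.one_mem
  by_cases h0 : ∑ i, r i = 0
  · have : Matrix.det (fun i => v i (r i)) = 0 := by
      apply Matrix.exists_vecMul_eq_zero_iff.mp
      refine ⟨fun i => if i ∈ s then 1 else 0, ?_, ?_⟩
      · obtain ⟨i, hi⟩ := hs
        intro h
        have := congrFun h i
        simp [hi] at this
      · funext j
        simp only [Matrix.vecMul, dotProduct, Pi.zero_apply]
        have : ∑ i, r i j = 0 := by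
          have := congrFun h0 j
          simpa using this
        have := congrArg (φ H) this
        rw [map_sum, map_zero] at this
        refine Eq.trans ?_ this
        refine Finset.sum_congr rfl fun i _ => ?_
        by_cases hi : i ∈ s
        · simp [v, hi]
        · simp [hi, hr i hi]
    rw [this, mul_zero, map_zero]
  · have := G.mul_mem hc hv
    rw [add_zero] at this
    exact G.p_of_ne this h0

lemma p0_det_exact (hm : 0 < m) (g : Fin m → H) :
    G.p 0 (Matrix.det (fun i j => G.D j (g i))) = 0 :=
  G.p0_det Finset.univ ⟨⟨0, hm⟩, by simp⟩ g _ (fun _ _ _ => rfl) (by simp)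

lemma p0_det_log (u : Fin m → H) :
    G.p 0 (Matrix.det (fun i j => u i * G.D j (u i))) =
      (Matrix.det (fun i j => G.D j (u i))) ^ 2 := by
  classical
  choose g hg using fun i => G.cartier (u i)
  let X : Fin m → Fin m → H := fun i j => G.D j (g i)
  let Y : Fin m → Fin m → H := fun i j => (G.D j (u i)) ^ 2
  have e : (fun i j => u i * G.D j (u i)) = X + Y := by
    funext i j
    simp only [X, Y, Pi.add_apply]
    rw [hg, add_comm]
  have := (Matrix.detRowAlternating (n := Fin m) (R := H)).toMultilinearMap.map_add_univ X Y
  have e2 : Matrix.det (fun i j => u i * G.D j (u i)) =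
      ∑ s : Finset (Fin m), Matrix.det (s.piecewise X Y) := by
    rw [e]; exact this
  have hsq : Matrix.det Y = (Matrix.det (fun i j => G.D j (u i))) ^ 2 := by
    have := RingHom.map_det (frobenius H 2) (fun i j => G.D j (u i))
    rw [frobenius_def] at this
    rw [this]; rfl
  rw [e2, map_sum, Finset.sum_eq_single ∅]
  · rw [Finset.piecewise_empty, hsq]
    exact G.p_of_mem (G.sq_mem _)
  · intro s _ hs
    refine G.p0_det s (Finset.nonempty_iff_ne_empty.mpr hs) g _ ?_ ?_
    · intro i hi j; simp [hi, X]
    · intro i hi j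
      simp only [hi, not_false_eq_true, Finset.piecewise_eq_of_notMem, Y]
      exact G.sq_mem _
  · simp

/-- the logarithmic case -/
lemma log_case (y : H) (u : Fin m → H) (hu : ∀ i, u i ≠ 0) :
    G.p 0 (y ^ 2 * Matrix.det (fun i j => (u i)⁻¹ * G.D j (u i))) =
      (y * Matrix.det (fun i j => (u i)⁻¹ * G.D j (u i))) ^ 2 := by
  have e1 : Matrix.det (fun i j => (u i)⁻¹ * G.D j (u i)) =
      (∏ i, (u i)⁻¹) * Matrix.det (fun i j => G.D j (u i)) :=
    Matrix.det_mul_column (fun i => (u i)⁻¹) (fun i j => G.D j (u i))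
  have e2 : Matrix.det (fun i j => u i * G.D j (u i)) =
      (∏ i, u i) * Matrix.det (fun i j => G.D j (u i)) :=
    Matrix.det_mul_column u (fun i j => G.D j (u i))
  have h3 := G.p0_det_log u
  rw [e2] at h3
  have hne : (∏ i, u i) ≠ 0 := Finset.prod_ne_zero_iff.mpr fun i _ => hu i
  rw [e1, Finset.prod_inv_distrib]
  set P := ∏ i, u i
  set d := Matrix.det (fun i j => G.D j (u i))
  rw [show y ^ 2 * (P⁻¹ * d) = (y * P⁻¹) ^ 2 * (P * d) by field_simp, G.p0_mul (G.sq_mem _), h3]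
  ring

end KGr

open HahnSeries

abbrev KΓ (m : ℕ) := Lex (Fin (m + 1) → ℤ)
abbrev KH (F : Type*) [Field F] (m : ℕ) := HahnSeries (KΓ m) F

instance (F : Type*) [Field F] [CharP F 2] (m : ℕ) : CharP (KH F m) 2 :=
  charP_of_injective_ringHom (f := (HahnSeries.C : F →+* KH F m)) HahnSeries.C_injective 2

def Kχ (m : ℕ) : KΓ m →+ (Fin m → ZMod 2) where
  toFun a j := ((ofLex a (Fin.castSucc j) : ℤ) : ZMod 2)
  map_zero' := by funext j; exact Int.cast_zero
  map_add' a b := by funext j; exact Int.cast_add _ _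

def Kp (F : Type*) [Field F] (m : ℕ) (e : Fin m → ZMod 2) : KH F m →+ KH F m where
  toFun f := 
    { coeff := fun a => if Kχ m a = e then f.coeff a else 0
      isPWO_support' := f.isPWO_support.mono (by
        intro a ha
        simp only [Function.mem_support, ne_eq, ite_eq_right_iff, Classical.not_imp] at ha
        exact ha.2) }
  map_zero' := by ext a; simp
  map_add' f g := by
    ext a
    simp only [HahnSeries.coeff_add]
    split_ifs <;> simp

lemma Kp_coeff (F : Type*) [Field F] (m : ℕ) (e : Fin m → ZMod 2) (f : KH F m) (a : KΓ m) :
    (Kp F m e f).coeff a = if Kχ m a = e then f.coeff a else 0 := rfl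

def KG (F : Type*) [Field F] (m : ℕ) : KGr (KH F m) m where
  A e :=
    { carrier := {f | ∀ a, f.coeff a ≠ 0 → Kχ m a = e}
      zero_mem' := by intro a h; simp at h
      add_mem' := by
        intro f g hf hg a h
        by_contra h'
        have h1 : f.coeff a = 0 := by by_contra hh; exact h' (hf a hh)
        have h2 : g.coeff a = 0 := by by_contra hh; exact h' (hg a hh)
        exact h (by rw [HahnSeries.coeff_add, h1, h2, add_zero])
      neg_mem' := by
        intro f hf a h
        exact hf a (by simpa using h) }
  one_mem := by
    intro a h
    rw [HahnSeries.coeff_one] at h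
    have : a = 0 := by by_contra hh; simp [hh] at h
    rw [this, map_zero]
  mul_mem := by
    intro e e' f g hf hg a h
    obtain ⟨i, hi, j, hj, rfl⟩ := HahnSeries.support_mul_subset ((HahnSeries.mem_support _ _).2 h)
    rw [map_add, hf i hi, hg j hj]
  p := Kp F m
  p_mem := by
    intro e f a h
    rw [Kp_coeff] at h
    by_contra hh
    simp [hh] at h
  p_sum := by
    intro f
    ext a
    rw [HahnSeries.coeff_sum]
    simp [Kp_coeff]
  p_of_mem := by
    intro e f hf
    ext a
    rw [Kp_coeff]
    split_ifs with h
    · rfl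
    · by_contra hh
      exact h (hf a (Ne.symm hh))
  p_of_ne := by
    intro e e' f hf hne
    ext a
    rw [Kp_coeff]
    split_ifs with h
    · by_contra hh
      exact hne ((hf a hh).symm.trans h)
    · rfl

lemma Ksq0 (F : Type*) [Field F] [CharP F 2] (m : ℕ) (g : KH F m) (c : KΓ m)
    (h : ∀ b, b + b = c → g.coeff b = 0) : (g * g).coeff c = 0 := by
  rw [HahnSeries.coeff_mul]
  refine Finset.sum_involution (fun ij _ => (ij.2, ij.1)) ?_ ?_ ?_ ?_
  · intro ij _
    have : (2 : F) = 0 := CharTwo.two_eq_zero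
    linear_combination (g.coeff ij.1 * g.coeff ij.2) * this
  · intro ij hij hne heq
    have h1 : ij.2 = ij.1 := congrArg Prod.fst heq
    have h2 := Finset.mem_antidiagonal.mp hij
    apply hne
    rw [h ij.1 (by have := h2.2.2; rwa [h1] at this), zero_mul]
  · intro ij hij
    rw [Finset.mem_antidiagonal] at hij ⊢
    exact ⟨hij.2.1, hij.1, by rw [add_comm]; exact hij.2.2⟩
  · intro ij _; rfl

lemma Ksq (F : Type*) [Field F] [CharP F 2] (m : ℕ) (g : KH F m) (a : KΓ m) :
    (g ^ 2).coeff (a + a) = (g.coeff a) ^ 2 := by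
  set g' := g - single a (g.coeff a) with hg'
  have e : g ^ 2 = g' * g' + single (a + a) (g.coeff a ^ 2) := by
    rw [pow_two (g.coeff a), ← HahnSeries.single_mul_single]
    have h2 : (2 : KH F m) = 0 := CharTwo.two_eq_zero
    rw [hg']
    linear_combination (g * single a (g.coeff a) - single a (g.coeff a) ^ 2) * h2
  rw [e, HahnSeries.coeff_add, HahnSeries.coeff_single_same, Ksq0, zero_add]
  intro b hb
  have : b = a := by
    rcases lt_trichotomy b a with h | h | h
    · exact absurd hb (add_lt_add h h).ne
    · exact h
    · exact absurd hb (add_lt_add h h).ne'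
  rw [this, hg']
  simp

def Ke (m : ℕ) (i : Fin (m + 1)) : KΓ m := toLex (Pi.single i (-1))

lemma Kχ_e_last (m : ℕ) : Kχ m (Ke m (Fin.last m)) = 0 := by
  funext j
  simp [Kχ, Ke]

lemma Kχ_e (m : ℕ) (i : Fin m) : Kχ m (Ke m i.castSucc) = Pi.single i 1 := by
  funext j
  simp only [Kχ, Ke, AddMonoidHom.coe_mk, ZeroHom.coe_mk, ofLex_toLex, Pi.single_apply,
    Fin.castSucc_inj]
  split_ifs
  · decide
  · decide

lemma Ke_neg (m : ℕ) : Ke m (Fin.last m) < 0 := by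
  refine ⟨Fin.last m, ?_, ?_⟩
  · intro j hj
    change (Pi.single (Fin.last m) (-1) : Fin (m + 1) → ℤ) j = 0
    simp [hj.ne]
  · change (Pi.single (Fin.last m) (-1) : Fin (m + 1) → ℤ) (Fin.last m) < 0
    simp

lemma K_contra (F : Type*) [Field F] [CharP F 2] (m : ℕ) (g : KH F m)
    (h : (KG F m).p 0 (single (Ke m (Fin.last m)) 1) = g ^ 2 + (KG F m).p 0 g) : False := by
  set t := Ke m (Fin.last m) with ht
  have htn : t < 0 := Ke_neg m
  have hpar : ∀ b : KΓ m, b + b ≠ t := by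
    intro b hb
    have h5 : ofLex b (Fin.last m) + ofLex b (Fin.last m) = ofLex t (Fin.last m) :=
      congrFun (congrArg ofLex hb) (Fin.last m)
    have h6 : ofLex t (Fin.last m) = -1 := by simp [ht, Ke]
    omega
  have hc : ∀ k : ℕ, Kχ m ((2 ^ k) • t) = 0 := by
    intro k; rw [map_nsmul, Kχ_e_last, nsmul_zero]
  have key : ∀ k : ℕ, g.coeff ((2 ^ k) • t) ≠ 0 := by
    intro k
    induction k with
    | zero =>
      have h1 := congrArg (fun f => HahnSeries.coeff f t) h
      simp only [HahnSeries.coeff_add] at h1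
      change (Kp F m 0 _).coeff t = _ + (Kp F m 0 _).coeff t at h1
      have h0 : Kχ m t = 0 := Kχ_e_last m
      rw [Kp_coeff, Kp_coeff, if_pos h0, if_pos h0, pow_two, Ksq0] at h1
      · simp only [HahnSeries.coeff_single_same, zero_add] at h1
        simp [← h1]
      · intro b hb
        exfalso
        exact hpar b hb
    | succ k ih =>
      have h1 := congrArg (fun f => HahnSeries.coeff f ((2 ^ (k + 1)) • t)) h
      simp only [HahnSeries.coeff_add] at h1
      change (Kp F m 0 _).coeff _ = _ + (Kp F m 0 _).coeff _ at h1
      rw [Kp_coeff, Kp_coeff, if_pos (hc _), if_pos (hc _)] at h1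
      have e : (2 ^ (k + 1)) • t = (2 ^ k) • t + (2 ^ k) • t := by
        rw [← add_nsmul]; congr 1; ring
      have hne : (2 ^ (k + 1)) • t ≠ t := by
        rw [e]
        exact hpar _
      rw [HahnSeries.coeff_single_of_ne hne] at h1
      intro h2
      rw [h2, e, Ksq, add_zero] at h1
      exact ih (pow_eq_zero_iff (two_ne_zero) |>.mp h1.symm)
  obtain ⟨a, b, hab, hle⟩ := g.isPWO_support (fun k => ⟨(2 ^ k) • t, key k⟩)
  have hle' : (2 ^ a) • t ≤ (2 ^ b) • t := hle
  have hlt : (2 ^ b) • t < (2 ^ a) • t := by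
    have h7 := nsmul_lt_nsmul_left (neg_pos.mpr htn)
      (Nat.pow_lt_pow_right (by norm_num : 1 < 2) hab)
    rw [neg_nsmul, neg_nsmul] at h7
    exact neg_lt_neg_iff.mp h7
  exact absurd hle' (not_le.mpr hlt)

def KX (F : Type*) [Field F] (m : ℕ) (i : Fin (m + 1)) : KH F m := single (Ke m i) 1

def KexpN (m : ℕ) (d : Fin (m + 1) →₀ ℕ) : KΓ m := toLex (fun i => -(d i : ℤ))

lemma K_prod (F : Type*) [Field F] (m : ℕ) (d : Fin (m + 1) →₀ ℕ) :
    ∏ i, KX F m i ^ d i = single (KexpN m d) 1 := by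
  have : ∀ s : Finset (Fin (m + 1)), ∏ i ∈ s, KX F m i ^ d i =
      single (∑ i ∈ s, d i • Ke m i) 1 := by
    intro s
    induction s using Finset.induction_on with
    | empty => simp
    | insert a s ha ih =>
      rw [Finset.prod_insert ha, Finset.sum_insert ha, ih, KX, HahnSeries.single_pow,
        HahnSeries.single_mul_single]
      simp
  rw [this]
  congr 2
  apply ofLex.injective
  funext j
  have : ofLex (∑ i, d i • Ke m i) = ∑ i, d i • (Pi.single i (-1) : Fin (m + 1) → ℤ) := rfl
  rw [this, Finset.sum_apply]
  simp [KexpN, Pi.single_apply]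

def Kι (F : Type*) [Field F] (m : ℕ) : MvPolynomial (Fin (m + 1)) F →+* KH F m :=
  MvPolynomial.eval₂Hom HahnSeries.C (KX F m)

lemma Kι_coeff (F : Type*) [Field F] (m : ℕ) (q : MvPolynomial (Fin (m + 1)) F)
    (d : Fin (m + 1) →₀ ℕ) : (Kι F m q).coeff (KexpN m d) = q.coeff d := by
  have inj : Function.Injective (KexpN m) := by
    intro a b h
    ext i
    have := congrFun (congrArg ofLex h) i
    simpa [KexpN] using this
  rw [Kι, MvPolynomial.coe_eval₂Hom, MvPolynomial.eval₂_eq', HahnSeries.coeff_sum]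
  simp only [K_prod, HahnSeries.C_apply, HahnSeries.single_mul_single, zero_add, mul_one]
  rw [Finset.sum_eq_single d]
  · simp
  · intro b _ hb
    exact HahnSeries.coeff_single_of_ne (fun h => hb (inj h).symm)
  · intro h
    simpa using h

lemma Kι_inj (F : Type*) [Field F] (m : ℕ) : Function.Injective (Kι F m) := by
  rw [injective_iff_map_eq_zero]
  intro q hq
  ext d
  rw [← Kι_coeff, hq]; simp

section main
variable {H : Type*} [Field H] [CharP H 2] {m : ℕ} {L : Type*} [Field L] [Algebra L H]
  (G : KGr H m)

/-- the pulled back derivation -/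
def KD (j : Fin m) : Derivation ℤ L H :=
  Derivation.mk' ((G.D j).comp (algebraMap L H).toAddMonoidHom).toIntLinearMap
    (by
      intro a b
      change G.D j (algebraMap L H (a * b)) =
        a • G.D j (algebraMap L H b) + b • G.D j (algebraMap L H a)
      rw [map_mul, KGr.D_mul, Algebra.smul_def, Algebra.smul_def])

lemma KD_apply (j : Fin m) (a : L) : KD G j a = G.D j (algebraMap L H a) := rfl

def Krow : Ω[L⁄ℤ] →ₗ[L] (Fin m → H) :=
  LinearMap.pi fun j => (KD (L := L) G j).liftKaehlerDifferential

lemma Krow_D (a : L) :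
    Krow G (KaehlerDifferential.D ℤ L a) = fun j => G.D j (algebraMap L H a) := by
  funext j
  simp [Krow, KD_apply]

lemma Krow_update [DecidableEq (Fin m)] (v : Fin m → Ω[L⁄ℤ]) (i : Fin m) (z : Ω[L⁄ℤ]) :
    (fun k => Krow G (Function.update v i z k)) =
      Function.update (fun k => Krow G (v k)) i (Krow G z) := by
  funext k
  by_cases hk : k = i
  · subst hk; simp
  · simp [hk]

def KaltAux (f : (Fin m → H) [⋀^Fin m]→ₗ[H] H) : Ω[L⁄ℤ] [⋀^Fin m]→ₗ[L] H :=
  { toFun := fun v => f (fun i => Krow G (v i))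
    map_update_add' := by
      intro _ v i x y
      rw [Krow_update, Krow_update, Krow_update, map_add, f.map_update_add]
    map_update_smul' := by
      intro _ v i c x
      rw [Krow_update, Krow_update, map_smul, ← algebraMap_smul H c (Krow G x),
        f.map_update_smul, algebraMap_smul]
    map_eq_zero_of_eq' := by
      intro v i j hv hij
      exact f.map_eq_zero_of_eq _ (by simp [hv]) hij }

def Kalt : Ω[L⁄ℤ] [⋀^Fin m]→ₗ[L] H := KaltAux G Matrix.detRowAlternating

def Kc : ⋀[L]^m (Ω[L⁄ℤ]) →ₗ[L] H :=
  exteriorPower.alternatingMapLinearEquiv (Kalt G)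

lemma Kc_wedge (v : Fin m → Ω[L⁄ℤ]) :
    Kc G (KahlerWedge L m v) = Matrix.det (fun i => Krow G (v i)) :=
  exteriorPower.alternatingMapLinearEquiv_apply_ιMulti _ _

lemma Kc_log (u : Fin m → L) :
    Kc G (KahlerWedge L m (fun i => (u i)⁻¹ • KaehlerDifferential.D ℤ L (u i))) =
      Matrix.det (fun i j => (algebraMap L H (u i))⁻¹ * G.D j (algebraMap L H (u i))) := by
  rw [Kc_wedge]
  congr 1
  funext i j
  rw [map_smul, Krow_D, Pi.smul_apply, Algebra.smul_def, map_inv₀]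

def KT : AddSubgroup H where
  carrier := {f | ∃ g, G.p 0 f = g ^ 2 + G.p 0 g}
  zero_mem' := ⟨0, by simp⟩
  add_mem' := by
    rintro f f' ⟨g, hg⟩ ⟨g', hg'⟩
    refine ⟨g + g', ?_⟩
    rw [map_add, map_add, hg, hg', CharTwo.add_sq]
    ring
  neg_mem' := by
    rintro f ⟨g, hg⟩
    refine ⟨g, ?_⟩
    rw [← hg, CharTwo.neg_eq]

lemma K_le : exactSubgroup L m ⊔ artinSchreierSubgroup 2 L m ≤
      (KT G).comap (Kc (L := L) G).toAddMonoidHom := by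
  refine sup_le ?_ ?_
  · cases m with
    | zero => exact bot_le
    | succ k =>
      rw [exactSubgroup, AddSubgroup.closure_le]
      rintro _ ⟨g, rfl⟩
      refine ⟨0, ?_⟩
      have : (Kc (L := L) G).toAddMonoidHom
          (KahlerWedge L (k + 1) fun i => KaehlerDifferential.D ℤ L (g i)) = Matrix.det
          (fun i j => G.D j (algebraMap L H (g i))) := by
        refine (Kc_wedge G _).trans ?_
        simp only [Krow_D]
      rw [this, KGr.p0_det_exact _ (Nat.succ_pos k)]
      simp
  · rw [artinSchreierSubgroup, AddSubgroup.closure_le]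
    rintro _ ⟨y, u, hu, rfl⟩
    set c := Matrix.det (fun i j => (algebraMap L H (u i))⁻¹ *
        G.D j (algebraMap L H (u i))) with hc
    refine ⟨algebraMap L H y * c, ?_⟩
    have : (Kc (L := L) G).toAddMonoidHom ((y ^ 2 - y) •
        KahlerWedge L m (fun i => (u i)⁻¹ • KaehlerDifferential.D ℤ L (u i))) =
        (algebraMap L H y) ^ 2 * c + algebraMap L H y * c := by
      refine (map_smul (Kc (L := L) G) _ _).trans ?_
      rw [Kc_log, Algebra.smul_def, map_sub, map_pow, CharTwo.sub_eq_add, add_mul]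
    rw [this, map_add, KGr.log_case]
    intro i
    rw [ne_eq, map_eq_zero]
    exact hu i

end main

end helpers

/-- Over `L = F(x₁,…,xₙ)` with `F` algebraically closed of characteristic `2`
(realized as any field of fractions of the polynomial ring `F[x₁,…,xₙ]`),
the class of `xₙ · (dx₁/x₁) ∧ ⋯ ∧ (dx_{n−1}/x_{n−1})` is nonzero in `H^n_2(L)`. -/
theorem kato_class_ne_zero (F : Type*) [Field F] [IsAlgClosed F] [CharP F 2]
    (n : ℕ) (hn : 1 ≤ n)
    (L : Type*) [Field L] [Algebra (MvPolynomial (Fin n) F) L]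
    [IsFractionRing (MvPolynomial (Fin n) F) L]
    (x : Fin n → L) (hx : ∀ i, x i = algebraMap (MvPolynomial (Fin n) F) L (MvPolynomial.X i)) :
    (QuotientAddGroup.mk
        ((x ⟨n - 1, by omega⟩) •
          KahlerWedge L (n - 1)
            (fun i => (x (Fin.castLE (n.sub_le 1) i))⁻¹ •
              KaehlerDifferential.D ℤ L (x (Fin.castLE (n.sub_le 1) i)))) :
      KatoH 2 L (n - 1)) ≠ 0 := by
  obtain ⟨m, rfl⟩ : ∃ m, n = m + 1 := ⟨n - 1, by omega⟩
  let alg : Algebra L (KH F m) :=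
    (IsFractionRing.lift (K := L) (Kι_inj F m)).toAlgebra
  have hX : ∀ i, algebraMap L (KH F m) (x i) = KX F m i := by
    intro i
    rw [hx]
    change IsFractionRing.lift (K := L) (Kι_inj F m) _ = _
    rw [IsFractionRing.lift_algebraMap]
    simp [Kι]
  intro h0
  rw [QuotientAddGroup.eq_zero_iff] at h0
  obtain ⟨g, hg⟩ := K_le (KG F m) h0
  apply K_contra F m g
  rw [← hg]
  congr 1
  symm
  refine (map_smul (Kc (L := L) (KG F m)) _ _).trans ?_
  refine (congrArg _ (Kc_log (KG F m)
    (fun i => x (Fin.castLE ((m + 1).sub_le 1) i)))).trans ?_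
  have hdet : (fun i j : Fin m => (algebraMap L (KH F m) (x (Fin.castLE ((m + 1).sub_le 1) i)))⁻¹ *
      (KG F m).D j (algebraMap L (KH F m) (x (Fin.castLE ((m + 1).sub_le 1) i)))) =
      (1 : Matrix (Fin m) (Fin m) (KH F m)) := by
    funext i j
    rw [hX]
    have e : Fin.castLE ((m + 1).sub_le 1) i = Fin.castSucc i := rfl
    rw [e]
    have hmem : KX F m i.castSucc ∈ (KG F m).A (Pi.single i 1) := by
      intro a ha
      have : a = Ke m i.castSucc := by
        by_contra hh
        exact ha (HahnSeries.coeff_single_of_ne hh)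
      rw [this, Kχ_e]
    have hne : KX F m i.castSucc ≠ 0 := HahnSeries.single_ne_zero one_ne_zero
    rw [KGr.D_of_mem _ j hmem, Matrix.one_apply, Pi.single_apply]
    by_cases hij : i = j
    · subst hij
      simp [hne]
    · simp [hij, Ne.symm hij]
  refine (congrArg (fun M => x _ • Matrix.det M) hdet).trans ?_
  rw [Matrix.det_one, Algebra.smul_def, mul_one, hX]
  rfl

end
end
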